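/- Let W be the Weyl group of F_4 acting on ℝ^4, with short positive roots R_{+,s} = {e_j : 1≤j≤4} ∪ {(e_1±e_2±e_3±e_4)/2} and long positive roots R_{+,l} = {e_j±e_k : 1≤j<k≤4}, and Δ_a(x)=∏_{α∈R_{+,a}}(α,x). For Re(k_1),Re(k_2)≥0, ∫_{ℝ^4}|Δ_s(x)|^{2k_1}|Δ_l(x)|^{2k_2} dγ(x) = 2^{-12k_1} · [Γ(4(k_1+k_2)+1)Γ(6(k_1+k_2)+1)]/[Γ(k_1+k_2+1)Γ(3(k_1+k_2)+1)] · ∏_{j=1,2} [Γ(2k_j+1)Γ(3k_j+1)Γ(2k_j+2(k_1+k_2)+1)]/[Γ(k_j+1)²Γ(k_j+k_1+k_2+1)]. -/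

import Mathlib

open MeasureTheory Complex Finset

noncomputable section

/-- The product of linear forms over the short positive roots of `F₄`:
`Δ_s(x) = ∏_{j=1}^4 x_j · ∏_{±} (x₁ ± x₂ ± x₃ ± x₄)/2`. -/
def deltaShortF4 (x : Fin 4 → ℝ) : ℝ :=
  (∏ j, x j) *
    ∏ s : Fin 3 → Bool,
      ((x 0 + (if s 0 then 1 else -1) * x 1 + (if s 1 then 1 else -1) * x 2 +
        (if s 2 then 1 else -1) * x 3) / 2)

/-- The product of linear forms over the long positive roots of `F₄`:
`Δ_l(x) = ∏_{1≤j<k≤4} (x_j − x_k)(x_j + x_k)`. -/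
def deltaLongF4 (x : Fin 4 → ℝ) : ℝ :=
  ∏ p ∈ Finset.univ.filter (fun p : Fin 4 × Fin 4 => p.1 < p.2),
    (x p.1 - x p.2) * (x p.1 + x p.2)

/-- Squared Euclidean norm on `ℝ⁴`. -/
def normSqFour (x : Fin 4 → ℝ) : ℝ := ∑ i, x i ^ 2

/-- Polynomial growth of a real function on `ℝ⁴`. -/
def PolyGrowth (f : (Fin 4 → ℝ) → ℝ) : Prop :=
  ∃ (C : ℝ) (m : ℕ), ∀ x, |f x| ≤ C * (1 + normSqFour x) ^ m

lemma normSqFour_nonneg (x : Fin 4 → ℝ) : 0 ≤ normSqFour x :=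
  Finset.sum_nonneg fun _ _ => sq_nonneg _

lemma continuous_normSqFour : Continuous normSqFour := by
  unfold normSqFour; fun_prop

namespace PolyGrowth

lemma of_nonneg_const {f : (Fin 4 → ℝ) → ℝ} (hf : PolyGrowth f) :
    ∃ (C : ℝ) (m : ℕ), 0 ≤ C ∧ ∀ x, |f x| ≤ C * (1 + normSqFour x) ^ m := by
  obtain ⟨C, m, h⟩ := hf
  refine ⟨|C|, m, abs_nonneg _, fun x => (h x).trans ?_⟩
  have := normSqFour_nonneg x
  gcongr
  exact le_abs_self C

lemma const (c : ℝ) : PolyGrowth fun _ => c :=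
  ⟨|c|, 0, fun x => by simp⟩

lemma coord (i : Fin 4) : PolyGrowth fun x => x i := by
  refine ⟨1, 1, fun x => ?_⟩
  have h : x i ^ 2 ≤ normSqFour x :=
    Finset.single_le_sum (f := fun j => x j ^ 2) (fun _ _ => sq_nonneg _) (Finset.mem_univ i)
  rw [pow_one, one_mul, abs_le]
  constructor <;> nlinarith [sq_nonneg (x i - 1), sq_nonneg (x i + 1)]

lemma mul {f g : (Fin 4 → ℝ) → ℝ} (hf : PolyGrowth f) (hg : PolyGrowth g) :
    PolyGrowth fun x => f x * g x := by
  obtain ⟨C, m, hC, h⟩ := hf.of_nonneg_const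
  obtain ⟨D, n, hD, h'⟩ := hg.of_nonneg_const
  refine ⟨C * D, m + n, fun x => ?_⟩
  have := normSqFour_nonneg x
  rw [abs_mul, pow_add, mul_mul_mul_comm]
  exact mul_le_mul (h x) (h' x) (abs_nonneg _) (by positivity)

lemma add {f g : (Fin 4 → ℝ) → ℝ} (hf : PolyGrowth f) (hg : PolyGrowth g) :
    PolyGrowth fun x => f x + g x := by
  obtain ⟨C, m, hC, h⟩ := hf.of_nonneg_const
  obtain ⟨D, n, hD, h'⟩ := hg.of_nonneg_const
  refine ⟨C + D, m + n, fun x => ?_⟩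
  have h1 : 1 ≤ 1 + normSqFour x := by linarith [normSqFour_nonneg x]
  calc |f x + g x| ≤ |f x| + |g x| := abs_add_le _ _
    _ ≤ C * (1 + normSqFour x) ^ m + D * (1 + normSqFour x) ^ n := add_le_add (h x) (h' x)
    _ ≤ C * (1 + normSqFour x) ^ (m + n) + D * (1 + normSqFour x) ^ (m + n) := by
      gcongr <;> first | exact h1 | omega
    _ = _ := by ring

lemma rpow {f : (Fin 4 → ℝ) → ℝ} (hf : PolyGrowth f) {c : ℝ} (hc : 0 ≤ c) :
    PolyGrowth fun x => |f x| ^ c := by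
  obtain ⟨C, m, hC, h⟩ := hf.of_nonneg_const
  refine ⟨C ^ c, m * ⌈c⌉₊, fun x => ?_⟩
  have h1 : 1 ≤ 1 + normSqFour x := by linarith [normSqFour_nonneg x]
  rw [abs_of_nonneg (by positivity)]
  calc |f x| ^ c ≤ (C * (1 + normSqFour x) ^ m) ^ c :=
        Real.rpow_le_rpow (abs_nonneg _) (h x) hc
    _ = C ^ c * ((1 + normSqFour x) ^ m) ^ c := Real.mul_rpow hC (by positivity)
    _ ≤ C ^ c * ((1 + normSqFour x) ^ m) ^ (⌈c⌉₊ : ℝ) := by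
      gcongr
      · exact one_le_pow₀ h1
      · exact Nat.le_ceil c
    _ = _ := by rw [Real.rpow_natCast, pow_mul]

lemma mvPolynomial (p : MvPolynomial (Fin 4) ℝ) : PolyGrowth fun x => MvPolynomial.eval x p := by
  induction p using MvPolynomial.induction_on with
  | C a => simpa using const a
  | add p q hp hq => simpa using hp.add hq
  | mul_X p i hp => simpa using hp.mul (coord i)

/-- A continuous function of polynomial growth is integrable against a Gaussian. -/
lemma integrable {f : (Fin 4 → ℝ) → ℝ} (hf : PolyGrowth f) (hm : Measurable f) :
    Integrable fun x => f x * Real.exp (-normSqFour x / 2) := by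
  obtain ⟨C, m, hC, h⟩ := hf.of_nonneg_const
  have hint : Integrable fun x : Fin 4 → ℝ => ∏ i, Real.exp (-(1 / 4) * x i ^ 2) :=
    Integrable.fintype_prod (f := fun _ : Fin 4 => fun y : ℝ => Real.exp (-(1 / 4) * y ^ 2))
      fun _ => integrable_exp_neg_mul_sq (by norm_num)
  refine (hint.const_mul (C * (4 ^ m * m.factorial * Real.exp (1 / 4)))).mono'
    (hm.mul (by have := continuous_normSqFour; fun_prop)).aestronglyMeasurable
    (Filter.Eventually.of_forall fun x => ?_)
  have hS := normSqFour_nonneg x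
  have hp : (1 + normSqFour x) ^ m ≤
      4 ^ m * m.factorial * Real.exp ((1 + normSqFour x) / 4) := by
    have := Real.pow_div_factorial_le_exp ((1 + normSqFour x) / 4) (by positivity) m
    rw [div_le_iff₀ (by positivity), div_pow, div_le_iff₀ (by positivity)] at this
    linarith
  have he : ∏ i, Real.exp (-(1 / 4) * x i ^ 2) = Real.exp (-normSqFour x / 4) := by
    rw [← Real.exp_sum]
    congr 1
    rw [normSqFour, ← Finset.mul_sum]; ring
  rw [he, norm_mul, Real.norm_eq_abs, Real.norm_eq_abs, Real.abs_exp]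
  calc |f x| * Real.exp (-normSqFour x / 2)
      ≤ C * (4 ^ m * m.factorial * Real.exp ((1 + normSqFour x) / 4)) *
        Real.exp (-normSqFour x / 2) := by gcongr; exact (h x).trans (by gcongr)
    _ = C * (4 ^ m * m.factorial) * Real.exp ((1 + normSqFour x) / 4 + -normSqFour x / 2) := by
      rw [Real.exp_add]; ring
    _ = C * (4 ^ m * m.factorial) * Real.exp (1 / 4 + -normSqFour x / 4) := by congr 2; ring
    _ = _ := by rw [Real.exp_add]; ring

end PolyGrowth

open MvPolynomial in
lemma hasDerivAt_eval_line (p : MvPolynomial (Fin 4) ℝ) (x : Fin 4 → ℝ) (i : Fin 4) (r : ℝ) :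
    HasDerivAt (fun t : ℝ => eval (x + t • Pi.single i 1) p)
      (eval (x + r • Pi.single i 1) (pderiv i p)) r := by
  induction p using MvPolynomial.induction_on with
  | C a => simpa using hasDerivAt_const r a
  | add p q hp hq => simp only [map_add]; exact hp.add hq
  | mul_X p j hp =>
    have hX : HasDerivAt (fun t : ℝ => eval (x + t • Pi.single i 1) (X j : MvPolynomial (Fin 4) ℝ))
        (eval (x + r • Pi.single i 1) (pderiv i (X j : MvPolynomial (Fin 4) ℝ))) r := by
      by_cases h : j = i
      · subst h
        simpa using (hasDerivAt_id r).const_add (x j)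
      · simpa [pderiv_X_of_ne h, Pi.single_eq_of_ne h] using hasDerivAt_const r (x j)
    have := hp.mul hX
    simp only [Derivation.leibniz, smul_eq_mul, map_add, map_mul]
    exact this.congr_deriv (by ring)

open MvPolynomial in
lemma hasLineDerivAt_eval (p : MvPolynomial (Fin 4) ℝ) (x : Fin 4 → ℝ) (i : Fin 4) :
    HasLineDerivAt ℝ (fun x => eval x p) (eval x (pderiv i p)) x (Pi.single i 1) := by
  have := hasDerivAt_eval_line p x i 0
  rw [zero_smul, add_zero] at this
  exact this

section IntegrationByParts

variable (P₁ P₂ : MvPolynomial (Fin 4) ℝ) (k₁ k₂ : ℝ)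

/-- The weight `|P₁|^{2k₁} |P₂|^{2k₂} e^{-|x|²/2}`. -/
def mehtaWeight (x : Fin 4 → ℝ) : ℝ :=
  |MvPolynomial.eval x P₁| ^ (2 * k₁) * |MvPolynomial.eval x P₂| ^ (2 * k₂) *
    Real.exp (-normSqFour x / 2)

/-- The partial derivatives of `mehtaWeight`. -/
def mehtaWeightDeriv (i : Fin 4) (x : Fin 4 → ℝ) : ℝ :=
  (2 * k₁ * |MvPolynomial.eval x P₁| ^ (2 * k₁ - 2) * MvPolynomial.eval x P₁ *
        MvPolynomial.eval x (MvPolynomial.pderiv i P₁) * |MvPolynomial.eval x P₂| ^ (2 * k₂) +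
      |MvPolynomial.eval x P₁| ^ (2 * k₁) *
        (2 * k₂ * |MvPolynomial.eval x P₂| ^ (2 * k₂ - 2) * MvPolynomial.eval x P₂ *
          MvPolynomial.eval x (MvPolynomial.pderiv i P₂)) -
      |MvPolynomial.eval x P₁| ^ (2 * k₁) * |MvPolynomial.eval x P₂| ^ (2 * k₂) * x i) *
    Real.exp (-normSqFour x / 2)

variable {k₁ k₂}

lemma measurable_eval_four (p : MvPolynomial (Fin 4) ℝ) :
    Measurable fun x : Fin 4 → ℝ => MvPolynomial.eval x p :=
  (MvPolynomial.continuous_eval p).measurable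

lemma integrable_mul_mehtaWeight (hk₁ : 0 ≤ k₁) (hk₂ : 0 ≤ k₂) (p : MvPolynomial (Fin 4) ℝ) :
    Integrable fun x => MvPolynomial.eval x p * mehtaWeight P₁ P₂ k₁ k₂ x := by
  have h := ((PolyGrowth.mvPolynomial p).mul (((PolyGrowth.mvPolynomial P₁).rpow
    (c := 2 * k₁) (by positivity)).mul ((PolyGrowth.mvPolynomial P₂).rpow
    (c := 2 * k₂) (by positivity)))).integrable (by
      have := measurable_eval_four p
      have := measurable_eval_four P₁
      have := measurable_eval_four P₂
      fun_prop)
  refine h.congr (Filter.Eventually.of_forall fun x => ?_)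
  simp only [mehtaWeight]; ring

lemma integrable_mul_mehtaWeightDeriv (hk₁ : 1 ≤ k₁) (hk₂ : 1 ≤ k₂) (i : Fin 4)
    (p : MvPolynomial (Fin 4) ℝ) :
    Integrable fun x => MvPolynomial.eval x p * mehtaWeightDeriv P₁ P₂ k₁ k₂ i x := by
  have a₁ := (PolyGrowth.mvPolynomial P₁).rpow (c := 2 * k₁) (by positivity)
  have a₂ := (PolyGrowth.mvPolynomial P₂).rpow (c := 2 * k₂) (by positivity)
  have b₁ := (PolyGrowth.mvPolynomial P₁).rpow (c := 2 * k₁ - 2) (by linarith)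
  have b₂ := (PolyGrowth.mvPolynomial P₂).rpow (c := 2 * k₂ - 2) (by linarith)
  have m := measurable_eval_four p
  have m₁ := measurable_eval_four P₁
  have m₂ := measurable_eval_four P₂
  have d₁ := measurable_eval_four (MvPolynomial.pderiv i P₁)
  have d₂ := measurable_eval_four (MvPolynomial.pderiv i P₂)
  have h₁ := ((b₁.mul ((PolyGrowth.mvPolynomial (P₁ * MvPolynomial.pderiv i P₁ * p)).mul a₂)).mul
    (PolyGrowth.const (2 * k₁))).integrable (by simp only [map_mul]; fun_prop)
  have h₂ := ((b₂.mul ((PolyGrowth.mvPolynomial (P₂ * MvPolynomial.pderiv i P₂ * p)).mul a₁)).mul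
    (PolyGrowth.const (2 * k₂))).integrable (by simp only [map_mul]; fun_prop)
  have h₃ := ((a₁.mul a₂).mul ((PolyGrowth.mvPolynomial p).mul
    (PolyGrowth.coord i))).integrable (by fun_prop)
  refine ((h₁.add h₂).sub h₃).congr (Filter.Eventually.of_forall fun x => ?_)
  simp only [mehtaWeightDeriv, Pi.add_apply, Pi.sub_apply, map_mul]; ring

lemma hasLineDerivAt_mehtaWeight (hk₁ : 1 ≤ k₁) (hk₂ : 1 ≤ k₂) (i : Fin 4) (x : Fin 4 → ℝ) :
    HasLineDerivAt ℝ (mehtaWeight P₁ P₂ k₁ k₂) (mehtaWeightDeriv P₁ P₂ k₁ k₂ i x) x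
      (Pi.single i 1) := by
  have e₁ := hasDerivAt_eval_line P₁ x i 0
  have e₂ := hasDerivAt_eval_line P₂ x i 0
  have eN := hasDerivAt_eval_line (∑ j, MvPolynomial.X j ^ 2) x i 0
  have hN : MvPolynomial.pderiv i (∑ j, MvPolynomial.X j ^ 2 : MvPolynomial (Fin 4) ℝ) =
      2 * MvPolynomial.X i := by
    simp [Derivation.leibniz_pow, MvPolynomial.pderiv_X, Pi.single_apply]
  rw [hN] at eN
  have c₁ := (hasDerivAt_abs_rpow (MvPolynomial.eval (x + (0 : ℝ) • Pi.single i 1) P₁)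
    (p := 2 * k₁) (by linarith)).comp (0 : ℝ) e₁
  have c₂ := (hasDerivAt_abs_rpow (MvPolynomial.eval (x + (0 : ℝ) • Pi.single i 1) P₂)
    (p := 2 * k₂) (by linarith)).comp (0 : ℝ) e₂
  have c₃ := ((eN.neg).div_const 2).exp
  have := (c₁.mul c₂).mul c₃
  have hS (y : Fin 4 → ℝ) :
      normSqFour y = MvPolynomial.eval y (∑ j, MvPolynomial.X j ^ 2) := by simp [normSqFour]
  unfold HasLineDerivAt
  simp only [mehtaWeight, hS]
  refine this.congr_deriv ?_
  simp only [mehtaWeightDeriv, hS, Pi.mul_apply, Pi.neg_apply, Function.comp_apply, zero_smul,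
    add_zero, map_mul, MvPolynomial.eval_X, map_ofNat]
  ring

open MvPolynomial in
/-- Integration by parts against `mehtaWeight`, for polynomials `g` whose gradient is logarithmic
along the zero loci of `P₁` and `P₂`. -/
lemma integral_mehtaWeight_by_parts (hk₁ : 1 ≤ k₁) (hk₂ : 1 ≤ k₂)
    (f g A B : MvPolynomial (Fin 4) ℝ)
    (hA : ∑ i, pderiv i g * pderiv i P₁ = A * P₁)
    (hB : ∑ i, pderiv i g * pderiv i P₂ = B * P₂) :
    ∫ x, eval x (∑ i, pderiv i f * pderiv i g + f * (∑ i, pderiv i (pderiv i g)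
      + C (2 * k₁) * A + C (2 * k₂) * B - ∑ i, X i * pderiv i g)) * mehtaWeight P₁ P₂ k₁ k₂ x
      = 0 := by
  have key (i : Fin 4) :
      ∫ x, (eval x (pderiv i (f * pderiv i g)) * mehtaWeight P₁ P₂ k₁ k₂ x +
        eval x (f * pderiv i g) * mehtaWeightDeriv P₁ P₂ k₁ k₂ i x) = 0 := by
    have h₁ := integrable_mul_mehtaWeight P₁ P₂ (k₁ := k₁) (k₂ := k₂) (by linarith) (by linarith)
      (pderiv i (f * pderiv i g))
    have h₂ := integrable_mul_mehtaWeightDeriv P₁ P₂ hk₁ hk₂ i (f * pderiv i g)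
    rw [integral_add h₁ h₂]
    have := integral_bilinear_hasLineDerivAt_right_eq_neg_left_of_integrable
      (μ := (volume : Measure (Fin 4 → ℝ)))
      (f := fun x => eval x (f * pderiv i g)) (g := mehtaWeight P₁ P₂ k₁ k₂)
      (f' := fun x => eval x (pderiv i (f * pderiv i g)))
      (g' := mehtaWeightDeriv P₁ P₂ k₁ k₂ i) (B := ContinuousLinearMap.mul ℝ ℝ)
      (v := Pi.single i 1) h₁ h₂
      (integrable_mul_mehtaWeight P₁ P₂ (by linarith) (by linarith) _)
      (fun x _ => hasLineDerivAt_eval (f * pderiv i g) x i)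
      (fun x _ => hasLineDerivAt_mehtaWeight P₁ P₂ hk₁ hk₂ i x)
    simp only [ContinuousLinearMap.mul_apply'] at this
    rw [this]; ring
  have hsum := integral_finsetSum (μ := (volume : Measure (Fin 4 → ℝ))) Finset.univ
    (f := fun i x => eval x (pderiv i (f * pderiv i g)) * mehtaWeight P₁ P₂ k₁ k₂ x +
        eval x (f * pderiv i g) * mehtaWeightDeriv P₁ P₂ k₁ k₂ i x) (fun i _ =>
      (integrable_mul_mehtaWeight P₁ P₂ (by linarith) (by linarith) _).add
        (integrable_mul_mehtaWeightDeriv P₁ P₂ hk₁ hk₂ i _))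
  simp only [key, Finset.sum_const_zero] at hsum
  rw [← hsum]
  congr 1
  ext x
  have hA' := congrArg (eval x) hA
  have hB' := congrArg (eval x) hB
  have pw (y k : ℝ) (hk : 1 ≤ k) : |y| ^ (2 * k - 2) * y * y = |y| ^ (2 * k) := by
    rcases eq_or_ne y 0 with rfl | hy
    · simp [Real.zero_rpow (show 2 * k ≠ 0 by linarith)]
    · rw [mul_assoc, ← abs_mul_abs_self y, ← pow_two, ← Real.rpow_natCast,
        ← Real.rpow_add (abs_pos.2 hy)]
      congr 1; push_cast; ring
  have p₁ := pw (eval x P₁) k₁ hk₁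
  have p₂ := pw (eval x P₂) k₂ hk₂
  simp only [map_sum, map_mul] at hA' hB'
  simp only [Fin.sum_univ_four, Derivation.leibniz, smul_eq_mul, map_add, map_mul, map_sub,
    eval_C, eval_X, mehtaWeight, mehtaWeightDeriv] at hA' hB' ⊢
  rw [← p₁, ← p₂]
  linear_combination (-(eval x f * 2 * k₁ * |eval x P₁| ^ (2 * k₁ - 2) * eval x P₁ *
    |eval x P₂| ^ (2 * k₂ - 2) * eval x P₂ * eval x P₂ * Real.exp (-normSqFour x / 2))) * hA' -
    (eval x f * 2 * k₂ * |eval x P₁| ^ (2 * k₁ - 2) * eval x P₁ * eval x P₁ *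
    |eval x P₂| ^ (2 * k₂ - 2) * eval x P₂ * Real.exp (-normSqFour x / 2)) * hB'

/-- Integration of polynomials against `mehtaWeight`, as a linear functional. -/
def mehtaFunctional (hk₁ : 0 ≤ k₁) (hk₂ : 0 ≤ k₂) : MvPolynomial (Fin 4) ℝ →ₗ[ℝ] ℝ where
  toFun p := ∫ x, MvPolynomial.eval x p * mehtaWeight P₁ P₂ k₁ k₂ x
  map_add' p q := by
    rw [← integral_add (integrable_mul_mehtaWeight P₁ P₂ hk₁ hk₂ p)
      (integrable_mul_mehtaWeight P₁ P₂ hk₁ hk₂ q)]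
    simp only [map_add, add_mul]
  map_smul' c p := by
    rw [RingHom.id_apply, smul_eq_mul, ← integral_const_mul]
    simp only [MvPolynomial.smul_eval, mul_assoc]

end IntegrationByParts

namespace F4

open MvPolynomial

/-- The polynomial ring `ℝ[x₁, x₂, x₃, x₄]`. -/
abbrev Poly := MvPolynomial (Fin 4) ℝ

/-- `gradInner f g = ∇f · ∇g`, as a derivation in `g`. -/
def gradInner (f : Poly) : Derivation ℝ Poly Poly := ∑ i, pderiv i f • pderiv i

/-- The Laplacian. -/
def lap (f : Poly) : Poly := ∑ i, pderiv i (pderiv i f)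

lemma gradInner_apply (f g : Poly) : gradInner f g = ∑ i, pderiv i f * pderiv i g := by
  simp only [gradInner, Fin.sum_univ_four, Derivation.add_apply, Derivation.smul_apply, smul_eq_mul]

lemma gradInner_comm (f g : Poly) : gradInner f g = gradInner g f := by
  simp only [gradInner_apply, mul_comm]

lemma lap_mul (f g : Poly) : lap (f * g) = f * lap g + g * lap f + 2 * gradInner f g := by
  simp only [lap, gradInner_apply, Fin.sum_univ_four, Derivation.leibniz, smul_eq_mul, map_add]
  ring

lemma lap_add (f g : Poly) : lap (f + g) = lap f + lap g := by
  simp only [lap, map_add, Finset.sum_add_distrib]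

lemma lap_sub (f g : Poly) : lap (f - g) = lap f - lap g := by
  simp only [lap, map_sub, Finset.sum_sub_distrib]

lemma lap_natCast (n : ℕ) : lap (n : Poly) = 0 := by
  simp [lap]

/-- The invariant `∑ x_i²`. -/
def s : Poly := ∑ i, X i ^ 2

/-- The third elementary symmetric polynomial in the `x_i²`. -/
def e₃ : Poly :=
  X 0 ^ 2 * X 1 ^ 2 * X 2 ^ 2 + X 0 ^ 2 * X 1 ^ 2 * X 3 ^ 2 + X 0 ^ 2 * X 2 ^ 2 * X 3 ^ 2 +
    X 1 ^ 2 * X 2 ^ 2 * X 3 ^ 2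

/-- Together with `v`, this spans the two-dimensional space of harmonic quartic invariants of
`D₄`. -/
def a : Poly := 8 * (X 0 * X 1 * X 2 * X 3)

/-- Together with `a`, this spans the two-dimensional space of harmonic quartic invariants of
`D₄`. -/
def v : Poly :=
  s ^ 2 - 4 * (X 0 ^ 2 * X 1 ^ 2 + X 0 ^ 2 * X 2 ^ 2 + X 0 ^ 2 * X 3 ^ 2 +
    X 1 ^ 2 * X 2 ^ 2 + X 1 ^ 2 * X 3 ^ 2 + X 2 ^ 2 * X 3 ^ 2)

/-- The `F₄`-invariant of degree `6`. -/
def t : Poly := s * v + 24 * e₃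

/-- The `F₄`-invariant of degree `8`. -/
def q : Poly := v ^ 2 + 3 * a ^ 2

/-- The `F₄`-invariant of degree `12`. -/
def c : Poly := v ^ 3 - 9 * a ^ 2 * v

/-- The product of the short roots, up to the factor `2048`. -/
def ds : Poly := a * (v ^ 2 - a ^ 2)

/-- The product of the long roots. -/
def dl : Poly :=
  (X 0 ^ 2 - X 1 ^ 2) * (X 0 ^ 2 - X 2 ^ 2) * (X 0 ^ 2 - X 3 ^ 2) *
    (X 1 ^ 2 - X 2 ^ 2) * (X 1 ^ 2 - X 3 ^ 2) * (X 2 ^ 2 - X 3 ^ 2)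

lemma disc_eq : q ^ 3 - c ^ 2 = 27 * ds ^ 2 := by
  simp only [q, c, ds]; ring

lemma pderiv_s (i : Fin 4) : pderiv i s = 2 * X i := by
  simp [s, Derivation.leibniz_pow, pderiv_X, Pi.single_apply]

lemma gradInner_s_apply (f : Poly) : gradInner s f = 2 * ∑ i, X i * pderiv i f := by
  simp only [gradInner_apply, pderiv_s, Finset.mul_sum, mul_assoc]

lemma D_ofNat (D : Derivation ℝ Poly Poly) (n : ℕ) [n.AtLeastTwo] :
    D (ofNat(n) : Poly) = 0 := D.map_natCast n

lemma pderiv_X_eq (i j : Fin 4) : pderiv i (X j : Poly) = if j = i then 1 else 0 := by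
  rw [pderiv_X, Pi.single_apply]

lemma gradInner_s_s : gradInner s s = 4 * s := by
  simp only [gradInner_apply, Fin.sum_univ_four, s, map_add, Derivation.leibniz_pow, pderiv_X_eq,
    Fin.reduceEq, if_true, if_false, smul_eq_mul, nsmul_eq_mul]
  push_cast
  ring

lemma gradInner_s_a : gradInner s a = 8 * a := by
  simp only [gradInner_apply, Fin.sum_univ_four, s, a, map_add, Derivation.leibniz,
    Derivation.leibniz_pow, D_ofNat, pderiv_X_eq, Fin.reduceEq, if_true, if_false, smul_eq_mul,
    nsmul_eq_mul]
  push_cast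
  ring

lemma gradInner_s_v : gradInner s v = 8 * v := by
  simp only [gradInner_apply, Fin.sum_univ_four, s, v, map_add, map_sub, Derivation.leibniz,
    Derivation.leibniz_pow, D_ofNat, pderiv_X_eq, Fin.reduceEq, if_true, if_false, smul_eq_mul,
    nsmul_eq_mul]
  push_cast
  ring

lemma gradInner_s_e₃ : gradInner s e₃ = 12 * e₃ := by
  simp only [gradInner_apply, Fin.sum_univ_four, s, e₃, map_add, Derivation.leibniz,
    Derivation.leibniz_pow, pderiv_X_eq, Fin.reduceEq, if_true, if_false, smul_eq_mul, nsmul_eq_mul]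
  push_cast
  ring

lemma gradInner_a_a : gradInner a a = 64 * e₃ := by
  simp only [gradInner_apply, Fin.sum_univ_four, a, e₃, Derivation.leibniz, D_ofNat, pderiv_X_eq,
    Fin.reduceEq, if_true, if_false, smul_eq_mul]
  ring

lemma gradInner_a_v : gradInner a v = -(8 * s * a) := by
  simp only [gradInner_apply, Fin.sum_univ_four, a, v, s, map_add, map_sub, Derivation.leibniz,
    Derivation.leibniz_pow, D_ofNat, pderiv_X_eq, Fin.reduceEq, if_true, if_false, smul_eq_mul,
    nsmul_eq_mul]
  push_cast
  ring

lemma gradInner_v_v : gradInner v v = 16 * s * v + 192 * e₃ := by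
  simp only [gradInner_apply, Fin.sum_univ_four, v, s, e₃, map_add, map_sub, Derivation.leibniz,
    Derivation.leibniz_pow, D_ofNat, pderiv_X_eq, Fin.reduceEq, if_true, if_false, smul_eq_mul,
    nsmul_eq_mul]
  push_cast
  ring

lemma gradInner_a_e₃ : gradInner a e₃ = s ^ 2 * a - a * v := by
  simp only [gradInner_apply, Fin.sum_univ_four, a, e₃, s, v, map_add, Derivation.leibniz,
    Derivation.leibniz_pow, D_ofNat, pderiv_X_eq, Fin.reduceEq, if_true, if_false, smul_eq_mul,
    nsmul_eq_mul]
  push_cast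
  ring

lemma gradInner_v_e₃ : gradInner v e₃ = -a ^ 2 - 8 * s * e₃ := by
  simp only [gradInner_apply, Fin.sum_univ_four, v, s, e₃, a, map_add, map_sub, Derivation.leibniz,
    Derivation.leibniz_pow, D_ofNat, pderiv_X_eq, Fin.reduceEq, if_true, if_false, smul_eq_mul,
    nsmul_eq_mul]
  push_cast
  ring

lemma gradInner_s_dl : gradInner s dl = 24 * dl := by
  simp only [gradInner_apply, Fin.sum_univ_four, s, dl, map_add, map_sub, Derivation.leibniz,
    Derivation.leibniz_pow, pderiv_X_eq, Fin.reduceEq, if_true, if_false, smul_eq_mul, nsmul_eq_mul]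
  push_cast
  ring

lemma gradInner_a_dl : gradInner a dl = 0 := by
  simp only [gradInner_apply, Fin.sum_univ_four, a, dl, map_sub, Derivation.leibniz,
    Derivation.leibniz_pow, D_ofNat, pderiv_X_eq, Fin.reduceEq, if_true, if_false, smul_eq_mul,
    nsmul_eq_mul]
  push_cast
  ring

lemma gradInner_v_dl : gradInner v dl = 0 := by
  simp only [gradInner_apply, Fin.sum_univ_four, v, s, dl, map_add, map_sub, Derivation.leibniz,
    Derivation.leibniz_pow, D_ofNat, pderiv_X_eq, Fin.reduceEq, if_true, if_false, smul_eq_mul,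
    nsmul_eq_mul]
  push_cast
  ring

lemma gradInner_e₃_dl : gradInner e₃ dl = (s ^ 2 - v) * dl := by
  simp only [gradInner_apply, Fin.sum_univ_four, e₃, dl, s, v, map_add, map_sub, Derivation.leibniz,
    Derivation.leibniz_pow, pderiv_X_eq, Fin.reduceEq, if_true, if_false, smul_eq_mul, nsmul_eq_mul]
  push_cast
  ring

lemma gradInner_e₃_e₃ : 16 * gradInner e₃ e₃ = 16 * (s ^ 2 - v) * e₃ + 3 * s * a ^ 2 := by
  simp only [gradInner_apply, Fin.sum_univ_four, e₃, s, v, a, map_add, Derivation.leibniz,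
    Derivation.leibniz_pow, pderiv_X_eq, Fin.reduceEq, if_true, if_false, smul_eq_mul, nsmul_eq_mul]
  push_cast
  ring

lemma lap_s : lap s = 8 := by
  simp only [lap, Fin.sum_univ_four, s, map_add, map_zero, Derivation.leibniz,
    Derivation.leibniz_pow, Derivation.map_one_eq_zero, Derivation.map_natCast, pderiv_X_eq,
    Fin.reduceEq, if_true, if_false, smul_eq_mul, nsmul_eq_mul]
  push_cast
  ring

lemma lap_a : lap a = 0 := by
  simp only [lap, Fin.sum_univ_four, a, map_add, map_zero, Derivation.leibniz,
    Derivation.map_one_eq_zero, D_ofNat, pderiv_X_eq, Fin.reduceEq, if_true, if_false, smul_eq_mul]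
  ring

lemma lap_e₃ : lap e₃ = s ^ 2 - v := by
  simp only [lap, Fin.sum_univ_four, e₃, v, s, map_add, map_zero, Derivation.leibniz,
    Derivation.leibniz_pow, Derivation.map_one_eq_zero, Derivation.map_natCast, pderiv_X_eq,
    Fin.reduceEq, if_true, if_false, smul_eq_mul, nsmul_eq_mul]
  push_cast
  ring

lemma lap_v : lap v = 0 := by
  simp only [lap, Fin.sum_univ_four, v, s, map_add, map_sub, map_zero, Derivation.leibniz,
    Derivation.leibniz_pow, Derivation.map_one_eq_zero, D_ofNat, Derivation.map_natCast,
    pderiv_X_eq, Fin.reduceEq, if_true, if_false, smul_eq_mul, nsmul_eq_mul]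
  push_cast
  ring

lemma gradInner_t (f : Poly) :
    gradInner t f = s * gradInner f v + v * gradInner f s + 24 * gradInner f e₃ := by
  rw [gradInner_comm]
  simp only [t, map_add, Derivation.leibniz, D_ofNat, smul_eq_mul]
  ring

lemma gradInner_q (f : Poly) : gradInner q f = 2 * v * gradInner f v + 6 * a * gradInner f a := by
  rw [gradInner_comm]
  simp only [q, map_add, Derivation.leibniz, Derivation.leibniz_pow, D_ofNat, smul_eq_mul,
    nsmul_eq_mul]
  push_cast
  ring

lemma gradInner_c (f : Poly) :
    gradInner c f = (3 * v ^ 2 - 9 * a ^ 2) * gradInner f v - 18 * a * v * gradInner f a := by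
  rw [gradInner_comm]
  simp only [c, map_sub, Derivation.leibniz, Derivation.leibniz_pow, D_ofNat, smul_eq_mul,
    nsmul_eq_mul]
  push_cast
  ring

lemma gradInner_ds (f : Poly) :
    gradInner ds f = (v ^ 2 - 3 * a ^ 2) * gradInner f a + 2 * a * v * gradInner f v := by
  rw [gradInner_comm]
  simp only [ds, map_sub, Derivation.leibniz, Derivation.leibniz_pow, smul_eq_mul, nsmul_eq_mul]
  push_cast
  ring

lemma gradInner_s_t : gradInner s t = 12 * t := by
  rw [gradInner_comm, gradInner_t, gradInner_s_v, gradInner_s_s, gradInner_s_e₃, t]; ring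

lemma gradInner_s_q : gradInner s q = 16 * q := by
  rw [gradInner_comm, gradInner_q, gradInner_s_v, gradInner_s_a, q]; ring

lemma gradInner_s_c : gradInner s c = 24 * c := by
  rw [gradInner_comm, gradInner_c, gradInner_s_v, gradInner_s_a, c]; ring

lemma gradInner_s_ds : gradInner s ds = 24 * ds := by
  rw [gradInner_comm, gradInner_ds, gradInner_s_v, gradInner_s_a, ds]; ring

lemma gradInner_t_a : gradInner t a = 16 * s ^ 2 * a - 16 * a * v := by
  rw [gradInner_t, gradInner_a_v, gradInner_a_e₃, gradInner_comm a s, gradInner_s_a]; ring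

lemma gradInner_t_v : gradInner t v = 16 * s ^ 2 * v - 24 * a ^ 2 + 8 * v ^ 2 := by
  rw [gradInner_t, gradInner_v_v, gradInner_v_e₃, gradInner_comm v s, gradInner_s_v]; ring

lemma gradInner_t_t : gradInner t t = 16 * s ^ 2 * t + 20 * s * q := by
  rw [gradInner_t, gradInner_t_v, gradInner_comm t s, gradInner_s_t, gradInner_t,
    gradInner_comm e₃ v, gradInner_v_e₃, gradInner_comm e₃ s, gradInner_s_e₃, t, q]
  linear_combination 36 * gradInner_e₃_e₃

lemma gradInner_t_q : gradInner t q = 32 * s ^ 2 * q + 16 * c := by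
  rw [gradInner_comm, gradInner_q, gradInner_t_v, gradInner_t_a, q, c]; ring

lemma gradInner_t_c : gradInner t c = 48 * s ^ 2 * c + 24 * q ^ 2 := by
  rw [gradInner_comm, gradInner_c, gradInner_t_v, gradInner_t_a, q, c]; ring

lemma gradInner_t_ds : gradInner t ds = 48 * s ^ 2 * ds := by
  rw [gradInner_comm, gradInner_ds, gradInner_t_v, gradInner_t_a, ds]; ring

lemma gradInner_q_q : gradInner q q = 32 * (s * c + q * t) := by
  rw [gradInner_q, gradInner_q, gradInner_q, gradInner_v_v, gradInner_comm v a, gradInner_a_v,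
    gradInner_a_a, q, c, t]
  ring

lemma gradInner_q_c : gradInner q c = 48 * (s * q ^ 2 + t * c) := by
  rw [gradInner_comm, gradInner_c, gradInner_q, gradInner_q, gradInner_v_v, gradInner_comm v a,
    gradInner_a_v, gradInner_a_a, q, c, t]
  ring

lemma gradInner_c_c : gradInner c c = 72 * (s * q * c + q ^ 2 * t) := by
  rw [gradInner_c, gradInner_c, gradInner_c, gradInner_v_v, gradInner_comm v a, gradInner_a_v,
    gradInner_a_a, q, c, t]
  ring

lemma gradInner_q_ds : gradInner q ds = 48 * t * ds := by
  rw [gradInner_comm, gradInner_ds, gradInner_q, gradInner_q, gradInner_v_v, gradInner_comm v a,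
    gradInner_a_v, gradInner_a_a, ds, t]
  ring

lemma gradInner_c_ds : gradInner c ds = 72 * s * q * ds := by
  rw [gradInner_comm, gradInner_ds, gradInner_c, gradInner_c, gradInner_v_v, gradInner_comm v a,
    gradInner_a_v, gradInner_a_a, ds, q]
  ring

lemma gradInner_t_dl : gradInner t dl = 24 * s ^ 2 * dl := by
  rw [gradInner_t, gradInner_comm dl v, gradInner_comm dl s, gradInner_comm dl e₃, gradInner_v_dl,
    gradInner_s_dl, gradInner_e₃_dl]
  ring

lemma gradInner_q_dl : gradInner q dl = 0 := by
  rw [gradInner_q, gradInner_comm dl v, gradInner_comm dl a, gradInner_v_dl, gradInner_a_dl]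
  ring

lemma gradInner_c_dl : gradInner c dl = 0 := by
  rw [gradInner_c, gradInner_comm dl v, gradInner_comm dl a, gradInner_v_dl, gradInner_a_dl]
  ring

lemma lap_ofNat (n : ℕ) [n.AtLeastTwo] : lap (ofNat(n) : Poly) = 0 := lap_natCast n

lemma lap_t : lap t = 24 * s ^ 2 := by
  rw [t, lap_add, lap_mul, lap_mul, lap_v, lap_s, lap_e₃, lap_ofNat, gradInner_s_v,
    gradInner_comm, D_ofNat]
  ring

lemma lap_q : lap q = 32 * t := by
  rw [q, lap_add, lap_mul, pow_two, pow_two, lap_mul, lap_mul, lap_v, lap_a, lap_ofNat,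
    gradInner_v_v, gradInner_a_a, gradInner_comm 3, D_ofNat, t]
  ring

lemma lap_c : lap c = 96 * s * q := by
  have hc : c = v * (v * v - 9 * (a * a)) := by rw [c]; ring
  rw [hc, lap_mul, lap_sub, lap_mul, lap_mul, lap_mul, lap_v, lap_a, lap_ofNat]
  simp only [map_sub, Derivation.leibniz, gradInner_comm 9, D_ofNat, smul_eq_mul, gradInner_v_v,
    gradInner_a_a, gradInner_comm v a, gradInner_a_v, q]
  ring
end F4

namespace F4
open MvPolynomial

/-- Weights for the Euler vector field `∇s` add up under multiplication. -/
lemma weight_mul {p p' : Poly} {d d' e : ℝ} (hp : gradInner s p = C (2 * d) * p)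
    (hp' : gradInner s p' = C (2 * d') * p') (he : d + d' = e) :
    gradInner s (p * p') = C (2 * e) * (p * p') := by
  rw [Derivation.leibniz, hp, hp', ← he, mul_add, C_add, smul_eq_mul, smul_eq_mul]
  ring

/-- A functional satisfying the integration by parts identities of the Macdonald-Mehta weight takes
on `ds ^ 2` an explicit multiple of its value at `1`. -/
theorem functional_ds_sq (E : Poly →ₗ[ℝ] ℝ) (k₁ k₂ : ℝ)
    (hs : ∀ f, E (gradInner s f) + (8 + 48 * k₁ + 48 * k₂) * E f - 2 * E (s * f) = 0)
    (ht : ∀ f, E (gradInner t f) + (24 + 96 * k₁ + 48 * k₂) * E (s ^ 2 * f) - 6 * E (t * f) = 0)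
    (hq : ∀ f, E (gradInner q f) + (32 + 96 * k₁) * E (t * f) - 8 * E (q * f) = 0)
    (hc : ∀ f, E (gradInner c f) + (96 + 144 * k₁) * E (s * q * f) - 12 * E (c * f) = 0) :
    E (ds ^ 2) = 1024 * (4 * (4 * (k₁ + k₂) + 1) * (4 * (k₁ + k₂) + 2) * (4 * (k₁ + k₂) + 3) * 8 *
      (6 * (k₁ + k₂) + 1) * (6 * (k₁ + k₂) + 3) * (6 * (k₁ + k₂) + 5) * 6 * (3 * k₁ + 1) *
      (3 * k₁ + 2) * (2 * k₁ + 1) * 4 * (2 * k₁ + 2 * (k₁ + k₂) + 1) *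
      (2 * k₁ + 2 * (k₁ + k₂) + 3) * 2 * (2 * k₂ + 2 * (k₁ + k₂) + 1)) * E 1 := by
  set N : ℝ := 4 + 24 * (k₁ + k₂) with hN
  have map_ofNat_mul (n : ℕ) [n.AtLeastTwo] (p : Poly) : E (ofNat(n) * p) = ofNat(n) * E p := by
    rw [← map_ofNat C n, ← smul_eq_C_mul, map_smul, smul_eq_mul]
  have mul_s {p : Poly} {d : ℝ} (hp : gradInner s p = C (2 * d) * p) :
      E (s * p) = (N + d) * E p := by
    have h := hs p
    rw [hp, ← smul_eq_C_mul, map_smul, smul_eq_mul] at h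
    linear_combination -h / 2 + E p * hN
  have w_s : gradInner s s = C (2 * 2) * s := by
    rw [gradInner_s_s, C_mul, map_ofNat]; ring
  have mul_s_sq {p : Poly} {d d' : ℝ} (hp : gradInner s p = C (2 * d) * p)
      (hd : 2 + d = d' := by norm_num) : E (s ^ 2 * p) = ((N + d') * (N + d)) * E p := by
    rw [pow_two, mul_assoc, mul_s (weight_mul w_s hp hd), mul_s hp, mul_assoc]
  have w_one : gradInner s 1 = C (2 * 0) * 1 := by
    rw [Derivation.map_one_eq_zero, mul_zero, C_0, zero_mul]
  have w_t : gradInner s t = C (2 * 6) * t := by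
    rw [gradInner_s_t, C_mul, map_ofNat, map_ofNat]; ring
  have w_q : gradInner s q = C (2 * 8) * q := by
    rw [gradInner_s_q, C_mul, map_ofNat, map_ofNat]; ring
  have w_c : gradInner s c = C (2 * 12) * c := by
    rw [gradInner_s_c, C_mul, map_ofNat, map_ofNat]; ring
  have w_tq : gradInner s (t * q) = C (2 * 14) * (t * q) :=
    weight_mul w_t w_q (by norm_num)
  have w_q2 : gradInner s (q ^ 2) = C (2 * 16) * q ^ 2 := by
    rw [pow_two]; exact weight_mul w_q w_q (by norm_num)
  have w_tc : gradInner s (t * c) = C (2 * 18) * (t * c) :=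
    weight_mul w_t w_c (by norm_num)
  have w_qc : gradInner s (q * c) = C (2 * 20) * (q * c) :=
    weight_mul w_q w_c (by norm_num)
  have s2_one : E (s ^ 2 * 1) = ((N + 2) * (N + 0)) * E 1 := mul_s_sq w_one
  have s2_t : E (s ^ 2 * t) = ((N + 8) * (N + 6)) * E t := mul_s_sq w_t
  have s1_q : E (s * q) = (N + 8) * E q := mul_s w_q
  have s2_q : E (s ^ 2 * q) = ((N + 10) * (N + 8)) * E q := mul_s_sq w_q
  have s1_c : E (s * c) = (N + 12) * E c := mul_s w_c
  have s2_c : E (s ^ 2 * c) = ((N + 14) * (N + 12)) * E c := mul_s_sq w_c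
  have s1_tq : E (s * (t * q)) = (N + 14) * E (t * q) := mul_s w_tq
  have s2_tq : E (s ^ 2 * (t * q)) = ((N + 16) * (N + 14)) * E (t * q) := mul_s_sq w_tq
  have s1_q2 : E (s * q ^ 2) = (N + 16) * E (q ^ 2) := mul_s w_q2
  have s2_q2 : E (s ^ 2 * q ^ 2) = ((N + 18) * (N + 16)) * E (q ^ 2) := mul_s_sq w_q2
  have s1_tc : E (s * (t * c)) = (N + 18) * E (t * c) := mul_s w_tc
  have s1_qc : E (s * (q * c)) = (N + 20) * E (q * c) := mul_s w_qc
  have r_t : E t = ((24 + 96 * k₁ + 48 * k₂) * ((N + 2) * (N + 0)) * E 1) / 6 := by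
    have h := ht 1
    rw [Derivation.map_one_eq_zero, map_zero, s2_one, mul_one] at h
    linear_combination -h / 6
  have r_q : E q = ((32 + 96 * k₁) * E t) / 8 := by
    have h := hq 1
    rw [Derivation.map_one_eq_zero, map_zero, mul_one, mul_one] at h
    linear_combination -h / 8
  have r_t2 : E (t ^ 2) = (16 * ((N + 8) * (N + 6)) * E t + 20 * (N + 8) * E q +
      (24 + 96 * k₁ + 48 * k₂) * ((N + 8) * (N + 6)) * E t) / 6 := by
    have h := ht t
    rw [show gradInner t t = 16 * (s ^ 2 * t) + 20 * (s * q) by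
        rw [gradInner_t_t]; ring,
      show t * t = t ^ 2 by ring] at h
    simp only [map_add, map_ofNat_mul, s2_t, s1_q] at h
    linear_combination -h / 6
  have r_c : E c = ((96 + 144 * k₁) * (N + 8) * E q) / 12 := by
    have h := hc 1
    rw [Derivation.map_one_eq_zero, map_zero, mul_one, mul_one, s1_q] at h
    linear_combination -h / 12
  have r_tq : E (t * q) = (32 * ((N + 10) * (N + 8)) * E q + 16 * E c +
      (32 + 96 * k₁) * E (t ^ 2)) / 8 := by
    have h := hq t
    rw [show gradInner q t = 32 * (s ^ 2 * q) + 16 * c by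
        rw [gradInner_comm q t, gradInner_t_q]; ring,
      show t * t = t ^ 2 by ring,
      show q * t = t * q by ring] at h
    simp only [map_add, map_ofNat_mul, s2_q] at h
    linear_combination -h / 8
  have r_q2 : E (q ^ 2) = (32 * (N + 12) * E c + 32 * E (t * q) +
      (32 + 96 * k₁) * E (t * q)) / 8 := by
    have h := hq q
    rw [show gradInner q q = 32 * (s * c) + 32 * (t * q) by
        rw [gradInner_q_q]; ring,
      show q * q = q ^ 2 by ring] at h
    simp only [map_add, map_ofNat_mul, s1_c] at h
    linear_combination -h / 8
  have r_tc : E (t * c) = (48 * ((N + 14) * (N + 12)) * E c + 24 * E (q ^ 2) +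
      (96 + 144 * k₁) * (N + 14) * E (t * q)) / 12 := by
    have h := hc t
    rw [show gradInner c t = 48 * (s ^ 2 * c) + 24 * q ^ 2 by
        rw [gradInner_comm c t, gradInner_t_c]; ring,
      show s * q * t = s * (t * q) by ring,
      show c * t = t * c by ring] at h
    simp only [map_add, map_ofNat_mul, s2_c, s1_tq] at h
    linear_combination -h / 12
  have r_t2q : E (t ^ 2 * q) = (48 * ((N + 16) * (N + 14)) * E (t * q) +
      20 * (N + 16) * E (q ^ 2) + 16 * E (t * c) +
      (24 + 96 * k₁ + 48 * k₂) * ((N + 16) * (N + 14)) * E (t * q)) / 6 := by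
    have h := ht (t * q)
    rw [show gradInner t (t * q) = 48 * (s ^ 2 * (t * q)) + 20 * (s * q ^ 2) + 16 * (t * c) by
        rw [Derivation.leibniz, smul_eq_mul, smul_eq_mul, gradInner_t_t, gradInner_t_q]; ring,
      show t * (t * q) = t ^ 2 * q by ring] at h
    simp only [map_add, map_ofNat_mul, s2_tq, s1_q2] at h
    linear_combination -h / 6
  have r_qc : E (q * c) = (48 * (N + 16) * E (q ^ 2) + 48 * E (t * c) +
      (96 + 144 * k₁) * (N + 16) * E (q ^ 2)) / 12 := by
    have h := hc q
    rw [show gradInner c q = 48 * (s * q ^ 2) + 48 * (t * c) by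
        rw [gradInner_comm c q, gradInner_q_c]; ring,
      show s * q * q = s * q ^ 2 by ring,
      show c * q = q * c by ring] at h
    simp only [map_add, map_ofNat_mul, s1_q2] at h
    linear_combination -h / 12
  have r_tq2 : E (t * q ^ 2) = (32 * ((N + 18) * (N + 16)) * E (q ^ 2) + 16 * E (q * c) +
      32 * (N + 18) * E (t * c) + 32 * E (t ^ 2 * q) + (32 + 96 * k₁) * E (t ^ 2 * q)) / 8 := by
    have h := hq (t * q)
    rw [show gradInner q (t * q) = 32 * (s ^ 2 * q ^ 2) + 16 * (q * c) + 32 * (s * (t * c)) +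
      32 * (t ^ 2 * q) by
        rw [Derivation.leibniz, smul_eq_mul, smul_eq_mul, gradInner_comm q t, gradInner_t_q,
          gradInner_q_q]; ring,
      show t * (t * q) = t ^ 2 * q by ring,
      show q * (t * q) = t * q ^ 2 by ring] at h
    simp only [map_add, map_ofNat_mul, s2_q2, s1_tc] at h
    linear_combination -h / 8
  have r_q3 : E (q ^ 3) = (64 * (N + 20) * E (q * c) + 64 * E (t * q ^ 2) +
      (32 + 96 * k₁) * E (t * q ^ 2)) / 8 := by
    have h := hq (q ^ 2)
    rw [show gradInner q (q ^ 2) = 64 * (s * (q * c)) + 64 * (t * q ^ 2) by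
        rw [pow_two, Derivation.leibniz, smul_eq_mul, gradInner_q_q]; ring,
      show t * q ^ 2 = t * q ^ 2 by ring,
      show q * q ^ 2 = q ^ 3 by ring] at h
    simp only [map_add, map_ofNat_mul, s1_qc] at h
    linear_combination -h / 8
  have r_c2 : E (c ^ 2) = (72 * (N + 20) * E (q * c) + 72 * E (t * q ^ 2) +
      (96 + 144 * k₁) * (N + 20) * E (q * c)) / 12 := by
    have h := hc c
    rw [show gradInner c c = 72 * (s * (q * c)) + 72 * (t * q ^ 2) by
        rw [gradInner_c_c]; ring,
      show s * q * c = s * (q * c) by ring,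
      show c * c = c ^ 2 by ring] at h
    simp only [map_add, map_ofNat_mul, s1_qc] at h
    linear_combination -h / 12
  have disc := congrArg E disc_eq
  rw [map_ofNat_mul, map_sub] at disc
  rw [← mul_right_inj' (show (27 : ℝ) ≠ 0 by norm_num), ← disc]
  simp only [r_c2, r_q3, r_tq2, r_qc, r_t2q, r_tc, r_q2, r_tq, r_c, r_t2, r_q, r_t, hN]
  ring

end F4

lemma prod_fin_three_bool (f : Bool → Bool → Bool → ℝ) :
    ∏ s : Fin 3 → Bool, f (s 0) (s 1) (s 2) = ∏ a, ∏ b, ∏ c, f a b c := by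
  simp only [← Fintype.prod_prod_type']
  exact Fintype.prod_equiv
    { toFun := fun s => (s 0, s 1, s 2)
      invFun := fun p => ![p.1, p.2.1, p.2.2]
      left_inv := fun s => by ext i; fin_cases i <;> rfl
      right_inv := fun _ => rfl } _ _ fun _ => rfl

lemma deltaShortF4_eq (x : Fin 4 → ℝ) :
    deltaShortF4 x = x 0 * x 1 * x 2 * x 3 * ((x 0 + x 1 + x 2 + x 3) * (x 0 + x 1 + x 2 - x 3) *
      (x 0 + x 1 - x 2 + x 3) * (x 0 + x 1 - x 2 - x 3) * (x 0 - x 1 + x 2 + x 3) *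
      (x 0 - x 1 + x 2 - x 3) * (x 0 - x 1 - x 2 + x 3) * (x 0 - x 1 - x 2 - x 3)) / 256 := by
  rw [deltaShortF4, Fin.prod_univ_four, prod_fin_three_bool fun a b c =>
    (x 0 + (if a then 1 else -1) * x 1 + (if b then 1 else -1) * x 2 +
      (if c then 1 else -1) * x 3) / 2]
  simp only [Fintype.prod_bool, if_true, Bool.false_eq_true, if_false, one_mul, neg_one_mul,
    ← sub_eq_add_neg]
  generalize x 0 + x 1 + x 2 + x 3 = y₁
  generalize x 0 + x 1 + x 2 - x 3 = y₂
  generalize x 0 + x 1 - x 2 + x 3 = y₃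
  generalize x 0 + x 1 - x 2 - x 3 = y₄
  generalize x 0 - x 1 + x 2 + x 3 = y₅
  generalize x 0 - x 1 + x 2 - x 3 = y₆
  generalize x 0 - x 1 - x 2 + x 3 = y₇
  generalize x 0 - x 1 - x 2 - x 3 = y₈
  ring

lemma deltaLongF4_eq (x : Fin 4 → ℝ) :
    deltaLongF4 x = (x 0 ^ 2 - x 1 ^ 2) * (x 0 ^ 2 - x 2 ^ 2) * (x 0 ^ 2 - x 3 ^ 2) *
      (x 1 ^ 2 - x 2 ^ 2) * (x 1 ^ 2 - x 3 ^ 2) * (x 2 ^ 2 - x 3 ^ 2) := by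
  rw [deltaLongF4, Finset.prod_filter, Fintype.prod_prod_type]
  simp [Fin.prod_univ_four]
  ring

namespace F4
open MvPolynomial

/-- `Δ_s` as a polynomial. -/
def shortPoly : Poly := C (1 / 2048) * ds

lemma eval_shortPoly (x : Fin 4 → ℝ) : eval x shortPoly = deltaShortF4 x := by
  simp only [shortPoly, ds, a, v, s, map_mul, map_sub, map_pow, eval_X, map_add, map_ofNat, eval_C,
    deltaShortF4_eq, Fin.sum_univ_four]
  ring

lemma eval_dl (x : Fin 4 → ℝ) : eval x dl = deltaLongF4 x := by
  simp only [dl, map_mul, map_sub, map_pow, eval_X, deltaLongF4_eq]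

end F4

/-- The weight `|Δ_s|^{2k₁} |Δ_l|^{2k₂} e^{-|x|²/2}` for real parameters. -/
def realWeightF4 (k₁ k₂ : ℝ) (x : Fin 4 → ℝ) : ℝ :=
  |deltaShortF4 x| ^ (2 * k₁) * |deltaLongF4 x| ^ (2 * k₂) * Real.exp (-normSqFour x / 2)

/-- The Macdonald-Mehta integral for real parameters, with respect to `e^{-|x|²/2} dx`. -/
def realMehtaF4 (k₁ k₂ : ℝ) : ℝ := ∫ x, realWeightF4 k₁ k₂ x

namespace F4
open MvPolynomial

lemma mehtaWeight_shortPoly_dl (k₁ k₂ : ℝ) :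
    mehtaWeight shortPoly dl k₁ k₂ = realWeightF4 k₁ k₂ := by
  ext x
  rw [mehtaWeight, eval_shortPoly, eval_dl, realWeightF4]

lemma mehtaFunctional_mul_sub {k₁ k₂ : ℝ} (hk₁ : 1 ≤ k₁) (hk₂ : 1 ≤ k₂) (f g A B : Poly)
    (hA : gradInner g ds = A * ds) (hB : gradInner g dl = B * dl) :
    mehtaFunctional shortPoly dl (zero_le_one.trans hk₁) (zero_le_one.trans hk₂)
      (gradInner g f + f * (lap g + C (2 * k₁) * A + C (2 * k₂) * B - C (1 / 2) * gradInner s g))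
      = 0 := by
  have hA' : ∑ i, pderiv i g * pderiv i shortPoly = A * shortPoly := by
    rw [← gradInner_apply, shortPoly, Derivation.leibniz, hA, ← algebraMap_eq,
      Derivation.map_algebraMap]
    simp only [smul_eq_mul]
    ring
  rw [gradInner_apply] at hB
  have h := integral_mehtaWeight_by_parts shortPoly dl hk₁ hk₂ f g A B hA' hB
  have hC : C (σ := Fin 4) (1 / 2 : ℝ) * 2 = 1 := by
    rw [← map_ofNat C 2, ← C_mul, ← C_1]; norm_num
  rw [gradInner_comm, gradInner_apply, gradInner_s_apply, lap, ← mul_assoc, hC, one_mul]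
  exact h

/-- The recurrence in the multiplicity of the short roots. -/
theorem realMehtaF4_add_one {k₁ k₂ : ℝ} (hk₁ : 1 ≤ k₁) (hk₂ : 1 ≤ k₂) :
    realMehtaF4 (k₁ + 1) k₂ =
      1 / 4096 * (4 * (4 * (k₁ + k₂) + 1) * (4 * (k₁ + k₂) + 2) * (4 * (k₁ + k₂) + 3) * 8 *
        (6 * (k₁ + k₂) + 1) * (6 * (k₁ + k₂) + 3) * (6 * (k₁ + k₂) + 5) * 6 * (3 * k₁ + 1) *
        (3 * k₁ + 2) * (2 * k₁ + 1) * 4 * (2 * k₁ + 2 * (k₁ + k₂) + 1) *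
        (2 * k₁ + 2 * (k₁ + k₂) + 3) * 2 * (2 * k₂ + 2 * (k₁ + k₂) + 1)) * realMehtaF4 k₁ k₂ := by
  set E := mehtaFunctional shortPoly dl (zero_le_one.trans hk₁) (zero_le_one.trans hk₂) with hE
  have e1 : E 1 = realMehtaF4 k₁ k₂ := by
    change ∫ x, eval x 1 * mehtaWeight shortPoly dl k₁ k₂ x = _
    simp only [mehtaWeight_shortPoly_dl, map_one, one_mul, realMehtaF4]
  have e2 : realMehtaF4 (k₁ + 1) k₂ = 1 / 4096 / 1024 * E (ds ^ 2) := by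
    rw [← smul_eq_mul, ← map_smul]
    change _ = ∫ x, eval x _ * mehtaWeight shortPoly dl k₁ k₂ x
    rw [realMehtaF4]
    congr 1
    ext x
    have : eval x ((1 / 4096 / 1024 : ℝ) • ds ^ 2) = |deltaShortF4 x| ^ (2 : ℝ) := by
      rw [← eval_shortPoly, shortPoly, map_mul, eval_C, smul_eval, map_pow, Real.rpow_two, sq_abs]
      ring
    rw [this, mehtaWeight_shortPoly_dl, realWeightF4, realWeightF4, mul_add,
      Real.rpow_add_of_nonneg (abs_nonneg _) (by linarith) (by norm_num), mul_one]
    ring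
  rw [e2, ← e1, functional_ds_sq E k₁ k₂]
  · ring
  · intro f
    have h := mehtaFunctional_mul_sub hk₁ hk₂ f s 24 24 gradInner_s_ds gradInner_s_dl
    rw [← hE, lap_s, gradInner_s_s, show gradInner s f + f * (8 + C (2 * k₁) * 24 +
      C (2 * k₂) * 24 - C (1 / 2) * (4 * s)) = gradInner s f + (8 + 48 * k₁ + 48 * k₂) • f - (2 : ℝ) • (s * f) by
        have : C (σ := Fin 4) (1 / 2 : ℝ) * 4 = 2 := by
          rw [← map_ofNat C 4, ← C_mul, ← map_ofNat C 2]; norm_num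
        simp only [smul_eq_C_mul, C_mul, C_add, map_ofNat]
        linear_combination (-f * s) * this] at h
    simpa only [map_add, map_sub, map_smul, smul_eq_mul] using h
  · intro f
    have h := mehtaFunctional_mul_sub hk₁ hk₂ f t (48 * s ^ 2) (24 * s ^ 2) gradInner_t_ds
      gradInner_t_dl
    rw [← hE, lap_t, gradInner_s_t, show gradInner t f + f * (24 * s ^ 2 +
      C (2 * k₁) * (48 * s ^ 2) + C (2 * k₂) * (24 * s ^ 2) - C (1 / 2) * (12 * t)) =
      gradInner t f + (24 + 96 * k₁ + 48 * k₂) • (s ^ 2 * f) - (6 : ℝ) • (t * f) by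
        have : C (σ := Fin 4) (1 / 2 : ℝ) * 12 = 6 := by
          rw [← map_ofNat C 12, ← C_mul, ← map_ofNat C 6]; norm_num
        simp only [smul_eq_C_mul, C_mul, C_add, map_ofNat]
        linear_combination (-f * t) * this] at h
    simpa only [map_add, map_sub, map_smul, smul_eq_mul] using h
  · intro f
    have h := mehtaFunctional_mul_sub hk₁ hk₂ f q (48 * t) 0 gradInner_q_ds
      (gradInner_q_dl.trans (zero_mul _).symm)
    rw [← hE, lap_q, gradInner_s_q, show gradInner q f + f * (32 * t +
      C (2 * k₁) * (48 * t) + C (2 * k₂) * 0 - C (1 / 2) * (16 * q)) =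
      gradInner q f + (32 + 96 * k₁) • (t * f) - (8 : ℝ) • (q * f) by
        have : C (σ := Fin 4) (1 / 2 : ℝ) * 16 = 8 := by
          rw [← map_ofNat C 16, ← C_mul, ← map_ofNat C 8]; norm_num
        simp only [smul_eq_C_mul, C_mul, C_add, map_ofNat]
        linear_combination (-f * q) * this] at h
    simpa only [map_add, map_sub, map_smul, smul_eq_mul] using h
  · intro f
    have h := mehtaFunctional_mul_sub hk₁ hk₂ f c (72 * s * q) 0 gradInner_c_ds
      (gradInner_c_dl.trans (zero_mul _).symm)
    rw [← hE, lap_c, gradInner_s_c, show gradInner c f + f * (96 * s * q +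
      C (2 * k₁) * (72 * s * q) + C (2 * k₂) * 0 - C (1 / 2) * (24 * c)) =
      gradInner c f + (96 + 144 * k₁) • (s * q * f) - (12 : ℝ) • (c * f) by
        have : C (σ := Fin 4) (1 / 2 : ℝ) * 24 = 12 := by
          rw [← map_ofNat C 24, ← C_mul, ← map_ofNat C 12]; norm_num
        simp only [smul_eq_C_mul, C_mul, C_add, map_ofNat]
        linear_combination (-f * c) * this] at h
    simpa only [map_add, map_sub, map_smul, smul_eq_mul] using h

end F4

/-- An orthogonal matrix exchanging the long and the short roots of `F₄`, up to scaling. -/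
def rootSwapF4 : Matrix (Fin 4) (Fin 4) ℝ :=
  !![√2⁻¹, √2⁻¹, 0, 0; √2⁻¹, -√2⁻¹, 0, 0; 0, 0, √2⁻¹, √2⁻¹; 0, 0, √2⁻¹, -√2⁻¹]

lemma rootSwapF4_apply (x : Fin 4 → ℝ) :
    Matrix.toLin' rootSwapF4 x =
      ![√2⁻¹ * (x 0 + x 1), √2⁻¹ * (x 0 - x 1), √2⁻¹ * (x 2 + x 3), √2⁻¹ * (x 2 - x 3)] := by
  ext i
  fin_cases i <;>
  simp [rootSwapF4, Matrix.toLin'_apply, Matrix.mulVec, dotProduct, Fin.sum_univ_four] <;> ring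

lemma sq_sqrt_two_inv : √2⁻¹ ^ 2 = (2⁻¹ : ℝ) := Real.sq_sqrt (by norm_num)

lemma det_rootSwapF4 : rootSwapF4.det = 1 := by
  have h := sq_sqrt_two_inv
  rw [rootSwapF4]
  generalize √2⁻¹ = r at *
  simp [Matrix.det_succ_row_zero, Fin.sum_univ_succ, Fin.succAbove]
  linear_combination (4 * r ^ 2 + 2) * h

lemma integral_comp_rootSwapF4 (f : (Fin 4 → ℝ) → ℝ) (hf : Measurable f) :
    ∫ x, f (Matrix.toLin' rootSwapF4 x) = ∫ x, f x := by
  have h := Real.map_matrix_volume_pi_eq_smul_volume_pi (M := rootSwapF4)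
    (by rw [det_rootSwapF4]; norm_num)
  rw [det_rootSwapF4, inv_one, abs_one, ENNReal.ofReal_one, one_smul] at h
  conv_rhs => rw [← h]
  rw [integral_map (LinearMap.continuous_of_finiteDimensional _).measurable.aemeasurable
    hf.aestronglyMeasurable]

lemma normSqFour_rootSwapF4 (x : Fin 4 → ℝ) :
    normSqFour (Matrix.toLin' rootSwapF4 x) = normSqFour x := by
  have h := sq_sqrt_two_inv
  rw [rootSwapF4_apply]
  simp only [normSqFour, Fin.sum_univ_four, Matrix.cons_val]
  linear_combination 2 * (x 0 ^ 2 + x 1 ^ 2 + x 2 ^ 2 + x 3 ^ 2) * h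

lemma deltaShortF4_rootSwapF4 (x : Fin 4 → ℝ) :
    deltaShortF4 (Matrix.toLin' rootSwapF4 x) = 1 / 64 * deltaLongF4 x := by
  have h := sq_sqrt_two_inv
  rw [rootSwapF4_apply, deltaShortF4_eq, deltaLongF4_eq]
  simp only [Matrix.cons_val]
  generalize √2⁻¹ = r at *
  rw [show r * (x 0 + x 1) + r * (x 0 - x 1) + r * (x 2 + x 3) + r * (x 2 - x 3) =
      2 * r * (x 0 + x 2) by ring,
    show r * (x 0 + x 1) + r * (x 0 - x 1) + r * (x 2 + x 3) - r * (x 2 - x 3) =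
      2 * r * (x 0 + x 3) by ring,
    show r * (x 0 + x 1) + r * (x 0 - x 1) - r * (x 2 + x 3) + r * (x 2 - x 3) =
      2 * r * (x 0 - x 3) by ring,
    show r * (x 0 + x 1) + r * (x 0 - x 1) - r * (x 2 + x 3) - r * (x 2 - x 3) =
      2 * r * (x 0 - x 2) by ring,
    show r * (x 0 + x 1) - r * (x 0 - x 1) + r * (x 2 + x 3) + r * (x 2 - x 3) =
      2 * r * (x 1 + x 2) by ring,
    show r * (x 0 + x 1) - r * (x 0 - x 1) + r * (x 2 + x 3) - r * (x 2 - x 3) =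
      2 * r * (x 1 + x 3) by ring,
    show r * (x 0 + x 1) - r * (x 0 - x 1) - r * (x 2 + x 3) + r * (x 2 - x 3) =
      2 * r * (x 1 - x 3) by ring,
    show r * (x 0 + x 1) - r * (x 0 - x 1) - r * (x 2 + x 3) - r * (x 2 - x 3) =
      2 * r * (x 1 - x 2) by ring]
  have h12 : r ^ 12 = 1 / 64 := by rw [show r ^ 12 = (r ^ 2) ^ 6 by ring, h]; norm_num
  simp only [sq_sub_sq]
  rw [← h12]
  generalize x 0 + x 1 = p₀₁, x 0 - x 1 = m₀₁, x 2 + x 3 = p₂₃, x 2 - x 3 = m₂₃,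
    x 0 + x 2 = p₀₂, x 0 - x 2 = m₀₂, x 1 + x 2 = p₁₂, x 1 - x 2 = m₁₂,
    x 0 + x 3 = p₀₃, x 0 - x 3 = m₀₃, x 1 + x 3 = p₁₃, x 1 - x 3 = m₁₃
  ring

lemma deltaLongF4_rootSwapF4 (x : Fin 4 → ℝ) :
    deltaLongF4 (Matrix.toLin' rootSwapF4 x) = 64 * deltaShortF4 x := by
  have h := sq_sqrt_two_inv
  rw [rootSwapF4_apply, deltaShortF4_eq, deltaLongF4_eq]
  simp only [Matrix.cons_val, sq_sub_sq]
  generalize √2⁻¹ = r at *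
  rw [show r * (x 0 + x 1) + r * (x 0 - x 1) = 2 * r * x 0 by ring,
    show r * (x 0 + x 1) - r * (x 0 - x 1) = 2 * r * x 1 by ring,
    show r * (x 2 + x 3) + r * (x 2 - x 3) = 2 * r * x 2 by ring,
    show r * (x 2 + x 3) - r * (x 2 - x 3) = 2 * r * x 3 by ring,
    show r * (x 0 + x 1) + r * (x 2 + x 3) = r * (x 0 + x 1 + x 2 + x 3) by ring,
    show r * (x 0 + x 1) - r * (x 2 + x 3) = r * (x 0 + x 1 - x 2 - x 3) by ring,
    show r * (x 0 + x 1) + r * (x 2 - x 3) = r * (x 0 + x 1 + x 2 - x 3) by ring,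
    show r * (x 0 + x 1) - r * (x 2 - x 3) = r * (x 0 + x 1 - x 2 + x 3) by ring,
    show r * (x 0 - x 1) + r * (x 2 + x 3) = r * (x 0 - x 1 + x 2 + x 3) by ring,
    show r * (x 0 - x 1) - r * (x 2 + x 3) = r * (x 0 - x 1 - x 2 - x 3) by ring,
    show r * (x 0 - x 1) + r * (x 2 - x 3) = r * (x 0 - x 1 + x 2 - x 3) by ring,
    show r * (x 0 - x 1) - r * (x 2 - x 3) = r * (x 0 - x 1 - x 2 + x 3) by ring]
  have h12 : (64 : ℝ) = 4096 * r ^ 12 := by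
    rw [show r ^ 12 = (r ^ 2) ^ 6 by ring, h]; norm_num
  rw [h12]
  generalize x 0 + x 1 + x 2 + x 3 = y₁, x 0 + x 1 + x 2 - x 3 = y₂, x 0 + x 1 - x 2 + x 3 = y₃,
    x 0 + x 1 - x 2 - x 3 = y₄, x 0 - x 1 + x 2 + x 3 = y₅, x 0 - x 1 + x 2 - x 3 = y₆,
    x 0 - x 1 - x 2 + x 3 = y₇, x 0 - x 1 - x 2 - x 3 = y₈
  ring

lemma measurable_deltaShortF4 : Measurable deltaShortF4 := by
  simpa only [F4.eval_shortPoly] using measurable_eval_four F4.shortPoly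

lemma measurable_deltaLongF4 : Measurable deltaLongF4 := by
  simpa only [F4.eval_dl] using measurable_eval_four F4.dl

lemma measurable_realWeightF4 (k₁ k₂ : ℝ) : Measurable (realWeightF4 k₁ k₂) := by
  have := measurable_deltaShortF4
  have := measurable_deltaLongF4
  have := continuous_normSqFour.measurable
  unfold realWeightF4
  fun_prop

lemma realMehtaF4_comm (k₁ k₂ : ℝ) :
    realMehtaF4 k₂ k₁ = (64 : ℝ) ^ (2 * k₁) / 64 ^ (2 * k₂) * realMehtaF4 k₁ k₂ := by
  rw [realMehtaF4, ← integral_comp_rootSwapF4 _ (measurable_realWeightF4 k₂ k₁), realMehtaF4,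
    ← integral_const_mul]
  congr 1
  ext x
  rw [realWeightF4, realWeightF4, deltaShortF4_rootSwapF4, deltaLongF4_rootSwapF4,
    normSqFour_rootSwapF4, abs_mul, abs_mul, Real.mul_rpow (abs_nonneg _) (abs_nonneg _),
    Real.mul_rpow (abs_nonneg _) (abs_nonneg _), abs_of_pos (by norm_num : (0 : ℝ) < 1 / 64),
    abs_of_pos (by norm_num : (0 : ℝ) < 64), one_div, Real.inv_rpow (by norm_num)]
  ring

open Filter Topology in
/-- Along the positive integers, `L` is asymptotically affine on unit intervals, with slowly varying
slope. -/
def AsympAffine (L : ℝ → ℝ) : Prop :=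
  Tendsto (fun n : ℕ => L (n + 2) - 2 * L (n + 1) + L n) atTop (𝓝 0) ∧
    ∀ t ∈ Set.Icc (0 : ℝ) 1,
      Tendsto (fun n : ℕ => L (n + 1 + t) - L (n + 1) - t * (L (n + 2) - L (n + 1))) atTop (𝓝 0)

namespace AsympAffine
open Filter Topology

variable {L M : ℝ → ℝ}

lemma add (hL : AsympAffine L) (hM : AsympAffine M) : AsympAffine fun x => L x + M x := by
  refine ⟨?_, fun t ht => ?_⟩
  · convert hL.1.add hM.1 using 2 <;> ring
  · convert (hL.2 t ht).add (hM.2 t ht) using 2 <;> ring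

lemma const_mul (hL : AsympAffine L) (r : ℝ) : AsympAffine fun x => r * L x := by
  refine ⟨?_, fun t ht => ?_⟩
  · convert hL.1.const_mul r using 2 <;> ring
  · convert (hL.2 t ht).const_mul r using 2 <;> ring

lemma affine (r r' : ℝ) : AsympAffine fun x => r * x + r' := by
  refine ⟨?_, fun t _ => ?_⟩
  · convert tendsto_const_nhds using 2; ring
  · convert tendsto_const_nhds using 2; ring

lemma congr (hL : AsympAffine L) (h : ∀ x, 1 ≤ x → M x = L x) : AsympAffine M := by
  refine ⟨hL.1.congr' ?_, fun t ht => (hL.2 t ht).congr fun n => ?_⟩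
  · filter_upwards [eventually_ge_atTop 1] with n hn
    have hn' : (1 : ℝ) ≤ n := by exact_mod_cast hn
    rw [h _ hn', h _ (by linarith), h _ (by linarith)]
  · have hn := n.cast_nonneg (α := ℝ)
    have := ht.1
    rw [h _ (by linarith), h _ (by linarith), h _ (by linarith)]

lemma of_convexOn (hL : ConvexOn ℝ (Set.Ici 1) L)
    (h : Tendsto (fun n : ℕ => L (n + 2) - 2 * L (n + 1) + L n) atTop (𝓝 0)) : AsympAffine L := by
  refine ⟨h, fun t ht => ?_⟩
  have h' : Tendsto (fun n : ℕ => -t * (L (n + 2) - 2 * L (n + 1) + L n)) atTop (𝓝 0) := by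
    simpa using h.const_mul (-t)
  refine tendsto_of_tendsto_of_tendsto_of_le_of_le' h' tendsto_const_nhds ?_ ?_
  · filter_upwards [eventually_ge_atTop 1] with n hn
    have hn' : (1 : ℝ) ≤ n := by exact_mod_cast hn
    have ht1 : 0 < 1 + t := by linarith [ht.1]
    have hc := hL.2 (x := n) (y := n + 1 + t) hn' (by simp only [Set.mem_Ici]; linarith)
      (div_nonneg ht.1 ht1.le) (div_nonneg zero_le_one ht1.le) (by field_simp; ring)
    rw [smul_eq_mul, smul_eq_mul, smul_eq_mul, smul_eq_mul, show t / (1 + t) * (n : ℝ) +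
      1 / (1 + t) * (n + 1 + t) = n + 1 by field_simp; ring, show t / (1 + t) * L n +
      1 / (1 + t) * L (n + 1 + t) = (t * L n + L (n + 1 + t)) / (1 + t) by ring,
      le_div_iff₀ ht1] at hc
    linarith
  · filter_upwards with n
    have hn := n.cast_nonneg (α := ℝ)
    have hc := hL.2 (x := n + 1) (y := n + 2) (by simp only [Set.mem_Ici]; linarith)
      (by simp only [Set.mem_Ici]; linarith) (sub_nonneg.2 ht.2) ht.1 (by ring)
    rw [smul_eq_mul, smul_eq_mul, smul_eq_mul, smul_eq_mul,
      show (1 - t) * ((n : ℝ) + 1) + t * (n + 2) = n + 1 + t by ring] at hc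
    linarith

/-- An asymptotically affine function with period `1` is constant. -/
lemma eq_of_periodic (hL : AsympAffine L) (hper : ∀ x, 1 ≤ x → L (x + 1) = L x) {x : ℝ}
    (hx : 1 ≤ x) : L x = L 1 := by
  have hadd (y : ℝ) (hy : 1 ≤ y) (n : ℕ) : L (y + n) = L y := by
    induction n with
    | zero => simp
    | succ n ih =>
      rw [Nat.cast_succ, ← add_assoc, hper _ (by have := n.cast_nonneg (α := ℝ); linarith), ih]
  obtain ⟨m, hm⟩ : ∃ m : ℕ, ⌊x⌋₊ = 1 + m := Nat.exists_eq_add_of_le (Nat.one_le_floor_iff x |>.2 hx)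
  have hfl := Nat.floor_le (zero_le_one.trans hx)
  have hfl' := Nat.lt_floor_add_one x
  have ht := hL.2 (x - ⌊x⌋₊) ⟨by linarith, by linarith⟩
  have hc (n : ℕ) : L (n + 1 + (x - ⌊x⌋₊)) - L (n + 1) - (x - ⌊x⌋₊) * (L (n + 2) - L (n + 1)) =
      L x - L 1 := by
    have e1 := hadd 1 le_rfl n
    have e2 := hadd 1 le_rfl (n + 1)
    have e3 := hadd (1 + (x - ⌊x⌋₊)) (by linarith) n
    have e4 := hadd (1 + (x - ⌊x⌋₊)) (by linarith) m
    push_cast at e2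
    rw [show 1 + (x - ⌊x⌋₊) + (m : ℝ) = x by rw [hm]; push_cast; ring] at e4
    rw [show (n : ℝ) + 1 + (x - ⌊x⌋₊) = 1 + (x - ⌊x⌋₊) + n by ring, e3, ← e4,
      add_comm (n : ℝ) 1, e1,
      show (n : ℝ) + 2 = 1 + (n + 1) by ring, e2]
    ring
  simp only [hc] at ht
  linarith [tendsto_nhds_unique ht tendsto_const_nhds]

end AsympAffine

/-- If `exp ∘ L` and `exp ∘ M` satisfy the same first-order difference equation, `L` is convex and
`M` is asymptotically affine, then they are proportional. -/
lemma sub_eq_sub_of_convexOn {L M : ℝ → ℝ} (hL : ConvexOn ℝ (Set.Ici 1) L) (hM : AsympAffine M)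
    (h : ∀ x, 1 ≤ x → L (x + 1) - L x = M (x + 1) - M x) {x : ℝ} (hx : 1 ≤ x) :
    L x - M x = L 1 - M 1 := by
  have hL' : AsympAffine L := by
    refine .of_convexOn hL (hM.1.congr' ?_)
    filter_upwards [Filter.eventually_ge_atTop 1] with n hn
    have hn' : (1 : ℝ) ≤ n := by exact_mod_cast hn
    have e1 := h n hn'
    have e2 := h (n + 1) (by linarith)
    rw [add_assoc, one_add_one_eq_two] at e2
    linarith
  have := (hL'.add (hM.const_mul (-1))).eq_of_periodic (fun y hy => by linarith [h y hy]) hx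
  linarith

lemma Real.Gamma_add_natCast_eq {y : ℝ} (hy : 0 < y) (m : ℕ) :
    Real.Gamma (y + m) = (∏ i ∈ range m, (y + i)) * Real.Gamma y := by
  induction m with
  | zero => simp
  | succ m ih =>
    rw [Nat.cast_succ, ← add_assoc, Real.Gamma_add_one (by positivity), ih, prod_range_succ]
    ring

open Filter Topology in
lemma asympAffine_log_Gamma {m : ℕ} (hm : 0 < m) {b : ℝ} (hb : 0 < b) :
    AsympAffine fun x => Real.log (Real.Gamma (m * x + b)) := by
  have hm' : (0 : ℝ) < m := by exact_mod_cast hm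
  refine .of_convexOn ?_ ?_
  · have := (Real.convexOn_log_Gamma.comp_affineMap
      (AffineMap.lineMap b (b + m) : ℝ →ᵃ[ℝ] ℝ)).subset (s := Set.Ici 1)
      (fun x hx => by
        have : (0 : ℝ) < x := zero_lt_one.trans_le hx
        simp only [Set.mem_preimage, AffineMap.lineMap_apply, vsub_eq_sub, smul_eq_mul, vadd_eq_add,
          Set.mem_Ioi]
        ring_nf; positivity) (convex_Ici 1)
    refine this.congr fun x _ => ?_
    simp only [Function.comp_apply, AffineMap.lineMap_apply, vsub_eq_sub, smul_eq_mul, vadd_eq_add]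
    ring_nf
  · have hlog {y : ℝ} (hy : 0 < y) : Real.log (Real.Gamma (y + m)) - Real.log (Real.Gamma y) =
        ∑ i ∈ range m, Real.log (y + i) := by
      rw [Real.Gamma_add_natCast_eq hy, Real.log_mul
        (prod_ne_zero_iff.2 fun i _ => by positivity) (Real.Gamma_pos_of_pos hy).ne',
        Real.log_prod fun i _ => by positivity]
      ring
    have hlim (i : ℕ) : Tendsto (fun n : ℕ => Real.log ((m * n + b + i) + m) -
        Real.log (m * n + b + i)) atTop (𝓝 0) := by
      refine (Real.tendsto_log_comp_add_sub_log (m : ℝ)).comp ?_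
      refine tendsto_atTop_add_const_right _ _ (tendsto_atTop_add_const_right _ _ ?_)
      exact tendsto_natCast_atTop_atTop.const_mul_atTop hm'
    have := tendsto_finsetSum (range m) fun i _ => hlim i
    rw [sum_const_zero] at this
    refine this.congr fun n => ?_
    have e1 := hlog (y := m * n + b) (by positivity)
    have e2 := hlog (y := m * n + b + m) (by positivity)
    rw [sum_sub_distrib, ← e1, show ∑ i ∈ range m, Real.log (m * n + b + i + m) =
      ∑ i ∈ range m, Real.log (m * n + b + m + i) from
        sum_congr rfl fun i _ => by rw [add_right_comm], ← e2]
    ring_nf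

lemma ae_sum_mul_ne_zero (c : Fin 4 → ℝ) {i : Fin 4} (hi : c i ≠ 0) :
    ∀ᵐ x : Fin 4 → ℝ, ∑ j, c j * x j ≠ 0 := by
  have h := Measure.addHaar_submodule (volume : Measure (Fin 4 → ℝ))
    (LinearMap.ker (Fintype.linearCombination ℝ c)) fun h => hi (by
      simpa using LinearMap.congr_fun (LinearMap.ker_eq_top.1 h) (Pi.single i 1))
  rw [ae_iff]
  convert h using 2
  ext x
  simp [Fintype.linearCombination_apply, mul_comm]

lemma ae_deltaShortF4_ne_zero : ∀ᵐ x, deltaShortF4 x ≠ 0 := by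
  have h₁ (j : Fin 4) : ∀ᵐ x : Fin 4 → ℝ, x j ≠ 0 := by
    simpa [Pi.single_apply] using ae_sum_mul_ne_zero (Pi.single j 1) (i := j) (by simp)
  have h₂ (s : Fin 3 → Bool) : ∀ᵐ x : Fin 4 → ℝ, (x 0 + (if s 0 then 1 else -1) * x 1 +
      (if s 1 then 1 else -1) * x 2 + (if s 2 then 1 else -1) * x 3) ≠ 0 := by
    have := ae_sum_mul_ne_zero (i := 0) (![1, if s 0 then 1 else -1, if s 1 then 1 else -1,
      if s 2 then 1 else -1]) (by simp)
    simpa only [Fin.sum_univ_four, Matrix.cons_val, one_mul] using this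
  filter_upwards [ae_all_iff.2 h₁, ae_all_iff.2 h₂] with x hx₁ hx₂
  exact mul_ne_zero (prod_ne_zero_iff.2 fun j _ => hx₁ j)
    (prod_ne_zero_iff.2 fun s _ => div_ne_zero (hx₂ s) two_ne_zero)

lemma ae_deltaLongF4_ne_zero : ∀ᵐ x, deltaLongF4 x ≠ 0 := by
  have h₁ (p : Fin 4 × Fin 4) (hp : p.1 < p.2) : ∀ᵐ x : Fin 4 → ℝ, x p.1 - x p.2 ≠ 0 := by
    have := ae_sum_mul_ne_zero (i := p.1) (Pi.single p.1 1 - Pi.single p.2 1) (by simp [hp.ne])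
    simpa [sub_mul, Pi.single_apply] using this
  have h₂ (p : Fin 4 × Fin 4) (hp : p.1 < p.2) : ∀ᵐ x : Fin 4 → ℝ, x p.1 + x p.2 ≠ 0 := by
    have := ae_sum_mul_ne_zero (i := p.1) (Pi.single p.1 1 + Pi.single p.2 1) (by simp [hp.ne])
    simpa [add_mul, sum_add_distrib, Pi.single_apply] using this
  have h (p : Fin 4 × Fin 4) :
      ∀ᵐ x : Fin 4 → ℝ, p.1 < p.2 → (x p.1 - x p.2) * (x p.1 + x p.2) ≠ 0 := by
    by_cases hp : p.1 < p.2
    · filter_upwards [h₁ p hp, h₂ p hp] with x hx₁ hx₂ _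
      exact mul_ne_zero hx₁ hx₂
    · exact Filter.Eventually.of_forall fun x h => absurd h hp
  filter_upwards [ae_all_iff.2 h] with x hx
  exact prod_ne_zero_iff.2 fun p hp => hx p (mem_filter.1 hp).2

lemma integrable_realWeightF4 {k₁ k₂ : ℝ} (hk₁ : 0 ≤ k₁) (hk₂ : 0 ≤ k₂) :
    Integrable (realWeightF4 k₁ k₂) := by
  simpa [F4.mehtaWeight_shortPoly_dl] using integrable_mul_mehtaWeight F4.shortPoly F4.dl hk₁ hk₂ 1

lemma realWeightF4_nonneg (k₁ k₂ : ℝ) (x : Fin 4 → ℝ) : 0 ≤ realWeightF4 k₁ k₂ x := by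
  unfold realWeightF4; positivity

lemma realMehtaF4_pos {k₁ k₂ : ℝ} (hk₁ : 0 ≤ k₁) (hk₂ : 0 ≤ k₂) : 0 < realMehtaF4 k₁ k₂ := by
  refine (integral_nonneg (realWeightF4_nonneg k₁ k₂)).lt_of_ne' fun h => ?_
  rw [integral_eq_zero_iff_of_nonneg (realWeightF4_nonneg k₁ k₂)
    (integrable_realWeightF4 hk₁ hk₂)] at h
  have : ∀ᵐ _ : Fin 4 → ℝ, False := by
    filter_upwards [h, ae_deltaShortF4_ne_zero, ae_deltaLongF4_ne_zero] with x hx h₁ h₂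
    have := abs_pos.2 h₁
    have := abs_pos.2 h₂
    refine (?_ : 0 < realWeightF4 k₁ k₂ x).ne' hx
    unfold realWeightF4; positivity
  rw [Filter.eventually_false_iff_eq_bot, ae_eq_bot] at this
  exact NeZero.ne _ this

lemma convexOn_log_realMehtaF4 {k₂ : ℝ} (hk₂ : 0 ≤ k₂) :
    ConvexOn ℝ (Set.Ici 1) fun k₁ => Real.log (realMehtaF4 k₁ k₂) := by
  refine ⟨convex_Ici 1, fun x hx y hy a b ha hb hab => ?_⟩
  have hx : 0 ≤ x := zero_le_one.trans hx
  have hy : 0 ≤ y := zero_le_one.trans hy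
  have hxy : 0 ≤ a * x + b * y := by positivity
  have px := realMehtaF4_pos hx hk₂
  have py := realMehtaF4_pos hy hk₂
  have pxy := realMehtaF4_pos hxy hk₂
  simp only [smul_eq_mul]
  rw [← Real.log_rpow px, ← Real.log_rpow py, ← Real.log_mul (by positivity) (by positivity)]
  refine Real.log_le_log pxy ?_
  set A := realMehtaF4 x k₂
  set B := realMehtaF4 y k₂
  have hle : ∀ᵐ z, realWeightF4 (a * x + b * y) k₂ z ≤ A ^ a * B ^ b *
      (a * (realWeightF4 x k₂ z / A) + b * (realWeightF4 y k₂ z / B)) := by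
    filter_upwards [ae_deltaShortF4_ne_zero, ae_deltaLongF4_ne_zero] with z h₁ h₂
    have h₁ := abs_pos.2 h₁
    have h₂ := abs_pos.2 h₂
    have wx := realWeightF4_nonneg x k₂ z
    have wy := realWeightF4_nonneg y k₂ z
    have key : realWeightF4 (a * x + b * y) k₂ z =
        realWeightF4 x k₂ z ^ a * realWeightF4 y k₂ z ^ b := by
      simp only [realWeightF4]
      rw [Real.mul_rpow (by positivity) (by positivity), Real.mul_rpow (by positivity)
        (by positivity), Real.mul_rpow (by positivity) (by positivity),
        Real.mul_rpow (by positivity) (by positivity), ← Real.rpow_mul h₁.le, ← Real.rpow_mul h₁.le,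
        ← Real.rpow_mul h₂.le, ← Real.rpow_mul h₂.le, ← Real.exp_mul, ← Real.exp_mul,
        show 2 * (a * x + b * y) = 2 * x * a + 2 * y * b by ring, Real.rpow_add h₁,
        show 2 * k₂ = 2 * k₂ * a + 2 * k₂ * b by rw [← mul_add, hab, mul_one], Real.rpow_add h₂,
        show -normSqFour z / 2 = -normSqFour z / 2 * a + -normSqFour z / 2 * b by
          rw [← mul_add, hab, mul_one], Real.exp_add]
      rw [← mul_add, ← mul_add, hab, mul_one, mul_one]
      ring
    have hyoung := Real.geom_mean_le_arith_mean2_weighted ha hb (div_nonneg wx px.le)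
      (div_nonneg wy py.le) hab
    rw [Real.div_rpow wx px.le, Real.div_rpow wy py.le] at hyoung
    rw [key]
    calc realWeightF4 x k₂ z ^ a * realWeightF4 y k₂ z ^ b
        = A ^ a * B ^ b *
          (realWeightF4 x k₂ z ^ a / A ^ a * (realWeightF4 y k₂ z ^ b / B ^ b)) := by
          have : A ^ a ≠ 0 := by positivity
          have : B ^ b ≠ 0 := by positivity
          field_simp
      _ ≤ _ := by gcongr
  have ix := integrable_realWeightF4 hx hk₂
  have iy := integrable_realWeightF4 hy hk₂
  have hi := ((ix.div_const A).const_mul a).add ((iy.div_const B).const_mul b)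
  refine (integral_mono_ae (integrable_realWeightF4 hxy hk₂) (hi.const_mul (A ^ a * B ^ b))
    hle).trans_eq ?_
  simp only [Pi.add_apply]
  rw [integral_const_mul,
    integral_add ((ix.div_const A).const_mul a) ((iy.div_const B).const_mul b),
    integral_const_mul, integral_const_mul, integral_div, integral_div]
  change A ^ a * B ^ b * (a * (A / A) + b * (B / B)) = _
  rw [div_self px.ne', div_self py.ne', mul_one, mul_one, hab, mul_one]

/-- The Garvan-Opdam product for real parameters. -/
def realGarvanOpdamF4 (k₁ k₂ : ℝ) : ℝ :=
  (2 : ℝ) ^ (-12 * k₁) *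
    (Real.Gamma (4 * (k₁ + k₂) + 1) * Real.Gamma (6 * (k₁ + k₂) + 1) /
      (Real.Gamma (k₁ + k₂ + 1) * Real.Gamma (3 * (k₁ + k₂) + 1))) *
    ((Real.Gamma (2 * k₁ + 1) * Real.Gamma (3 * k₁ + 1) *
        Real.Gamma (2 * k₁ + 2 * (k₁ + k₂) + 1) /
      (Real.Gamma (k₁ + 1) ^ 2 * Real.Gamma (k₁ + k₁ + k₂ + 1))) *
     (Real.Gamma (2 * k₂ + 1) * Real.Gamma (3 * k₂ + 1) *
        Real.Gamma (2 * k₂ + 2 * (k₁ + k₂) + 1) /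
      (Real.Gamma (k₂ + 1) ^ 2 * Real.Gamma (k₂ + k₁ + k₂ + 1))))

lemma realGarvanOpdamF4_pos {k₁ k₂ : ℝ} (hk₁ : 0 ≤ k₁) (hk₂ : 0 ≤ k₂) :
    0 < realGarvanOpdamF4 k₁ k₂ := by
  have h {y : ℝ} (hy : 0 < y) := Real.Gamma_pos_of_pos hy
  unfold realGarvanOpdamF4
  have := h (y := 4 * (k₁ + k₂) + 1) (by positivity)
  have := h (y := 6 * (k₁ + k₂) + 1) (by positivity)
  have := h (y := k₁ + k₂ + 1) (by positivity)
  have := h (y := 3 * (k₁ + k₂) + 1) (by positivity)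
  have := h (y := 2 * k₁ + 1) (by positivity)
  have := h (y := 3 * k₁ + 1) (by positivity)
  have := h (y := 2 * k₁ + 2 * (k₁ + k₂) + 1) (by positivity)
  have := h (y := k₁ + 1) (by positivity)
  have := h (y := k₁ + k₁ + k₂ + 1) (by positivity)
  have := h (y := 2 * k₂ + 1) (by positivity)
  have := h (y := 3 * k₂ + 1) (by positivity)
  have := h (y := 2 * k₂ + 2 * (k₁ + k₂) + 1) (by positivity)
  have := h (y := k₂ + 1) (by positivity)
  have := h (y := k₂ + k₁ + k₂ + 1) (by positivity)
  positivity

/-- The shift of `y ↦ Γ(my + 1)`. -/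
lemma Real.Gamma_natCast_mul_add_one {y : ℝ} (hy : 0 ≤ y) (m : ℕ) :
    Real.Gamma (m * (y + 1) + 1) =
      (∏ i ∈ range m, (m * y + 1 + i)) * Real.Gamma (m * y + 1) := by
  rw [← Real.Gamma_add_natCast_eq (by positivity)]
  ring_nf

lemma realGarvanOpdamF4_eq (k₁ k₂ : ℝ) :
    realGarvanOpdamF4 k₁ k₂ = (2 : ℝ) ^ (-12 * k₁) *
      (Real.Gamma (4 * (k₁ + k₂) + 1) / Real.Gamma (k₁ + k₂ + 1)) *
      (Real.Gamma (6 * (k₁ + k₂) + 1) / Real.Gamma (3 * (k₁ + k₂) + 1)) *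
      (Real.Gamma (2 * k₁ + 1) * Real.Gamma (3 * k₁ + 1) / Real.Gamma (k₁ + 1) ^ 2) *
      (Real.Gamma (2 * (k₁ + k₁ + k₂) + 1) / Real.Gamma (k₁ + k₁ + k₂ + 1)) *
      (Real.Gamma (2 * k₂ + 1) * Real.Gamma (3 * k₂ + 1) / Real.Gamma (k₂ + 1) ^ 2) *
      (Real.Gamma (2 * (k₂ + k₁ + k₂) + 1) / Real.Gamma (k₂ + k₁ + k₂ + 1)) := by
  rw [realGarvanOpdamF4, show 2 * (k₁ + k₁ + k₂) = 2 * k₁ + 2 * (k₁ + k₂) by ring,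
    show 2 * (k₂ + k₁ + k₂) = 2 * k₂ + 2 * (k₁ + k₂) by ring]
  simp only [div_eq_mul_inv, mul_inv]
  ac_rfl

lemma realGarvanOpdamF4_comm (k₁ k₂ : ℝ) :
    realGarvanOpdamF4 k₂ k₁ = (64 : ℝ) ^ (2 * k₁) / 64 ^ (2 * k₂) * realGarvanOpdamF4 k₁ k₂ := by
  have h (k : ℝ) : (64 : ℝ) ^ (2 * k) = (2 ^ (-12 * k))⁻¹ := by
    rw [← Real.rpow_neg (by norm_num), show (64 : ℝ) = 2 ^ (6 : ℝ) by norm_num,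
      ← Real.rpow_mul (by norm_num)]
    ring_nf
  have hp : (2 : ℝ) ^ (-12 * k₁) ≠ 0 := by positivity
  rw [realGarvanOpdamF4_eq, realGarvanOpdamF4_eq, h, h, add_comm k₂ k₁, add_right_comm k₂ k₂ k₁,
    add_right_comm k₁ k₂ k₁, inv_div_inv]
  generalize (2 : ℝ) ^ (-12 * k₁) = w at *
  simp only [← mul_assoc]
  rw [div_mul_cancel₀ _ hp]
  ac_rfl

lemma realGarvanOpdamF4_add_one {k₁ k₂ : ℝ} (hk₁ : 0 ≤ k₁) (hk₂ : 0 ≤ k₂) :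
    realGarvanOpdamF4 (k₁ + 1) k₂ = 1 / 4096 * (4 * (4 * (k₁ + k₂) + 1) * (4 * (k₁ + k₂) + 2) *
        (4 * (k₁ + k₂) + 3) * 8 * (6 * (k₁ + k₂) + 1) * (6 * (k₁ + k₂) + 3) *
        (6 * (k₁ + k₂) + 5) * 6 * (3 * k₁ + 1) * (3 * k₁ + 2) * (2 * k₁ + 1) * 4 *
        (2 * k₁ + 2 * (k₁ + k₂) + 1) * (2 * k₁ + 2 * (k₁ + k₂) + 3) * 2 *
        (2 * k₂ + 2 * (k₁ + k₂) + 1)) * realGarvanOpdamF4 k₁ k₂ := by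
  have g {y : ℝ} (hy : 0 ≤ y) := Real.Gamma_natCast_mul_add_one hy
  have g₁ {y : ℝ} (hy : 0 ≤ y) := g hy 1
  have g₂ {y : ℝ} (hy : 0 ≤ y) := g hy 2
  have g₃ {y : ℝ} (hy : 0 ≤ y) := g hy 3
  have g₄ {y : ℝ} (hy : 0 ≤ y) := g hy 4
  have g₆ {y : ℝ} (hy : 0 ≤ y) := g hy 6
  simp only [prod_range_succ, prod_range_zero, one_mul, Nat.cast_one, Nat.cast_zero, add_zero,
    Nat.cast_ofNat] at g₁ g₂ g₃ g₄ g₆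
  have p {y : ℝ} (hy : 0 ≤ y) : Real.Gamma (y + 1) ≠ 0 :=
    (Real.Gamma_pos_of_pos (by positivity)).ne'
  have h₁ {y : ℝ} (hy : 0 ≤ y) : Real.Gamma (4 * (y + 1) + 1) / Real.Gamma (y + 1 + 1) =
      4 * (4 * y + 1) * (4 * y + 2) * (4 * y + 3) *
        (Real.Gamma (4 * y + 1) / Real.Gamma (y + 1)) := by
    rw [g₄ hy, g₁ hy]
    have := p hy
    have : y + 1 ≠ 0 := by positivity
    field_simp
    ring
  have h₂ {y : ℝ} (hy : 0 ≤ y) : Real.Gamma (6 * (y + 1) + 1) / Real.Gamma (3 * (y + 1) + 1) =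
      8 * (6 * y + 1) * (6 * y + 3) * (6 * y + 5) *
        (Real.Gamma (6 * y + 1) / Real.Gamma (3 * y + 1)) := by
    rw [g₆ hy, g₃ hy, mul_div_mul_comm, div_mul_eq_mul_div, div_eq_iff (by positivity)]
    ring
  have h₃ {y : ℝ} (hy : 0 ≤ y) :
      Real.Gamma (2 * (y + 1) + 1) * Real.Gamma (3 * (y + 1) + 1) / Real.Gamma (y + 1 + 1) ^ 2 =
      6 * (3 * y + 1) * (3 * y + 2) * (2 * y + 1) *
        (Real.Gamma (2 * y + 1) * Real.Gamma (3 * y + 1) / Real.Gamma (y + 1) ^ 2) := by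
    rw [g₂ hy, g₃ hy, g₁ hy]
    have := p hy
    have : y + 1 ≠ 0 := by positivity
    field_simp
    ring
  have h₄ {y : ℝ} (hy : 0 ≤ y) : Real.Gamma (2 * (y + 1) + 1) / Real.Gamma (y + 1 + 1) =
      2 * (2 * y + 1) * (Real.Gamma (2 * y + 1) / Real.Gamma (y + 1)) := by
    rw [g₂ hy, g₁ hy]
    have := p hy
    have : y + 1 ≠ 0 := by positivity
    field_simp
    ring
  rw [realGarvanOpdamF4_eq, realGarvanOpdamF4_eq, add_right_comm k₁ 1 k₂, h₁ (by positivity),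
    h₂ (by positivity), h₃ hk₁, show k₁ + 1 + (k₁ + 1) + k₂ = k₁ + k₁ + k₂ + 1 + 1 by ring,
    h₄ (y := k₁ + k₁ + k₂ + 1) (by positivity), h₄ (y := k₁ + k₁ + k₂) (by positivity),
    show k₂ + (k₁ + 1) + k₂ = k₂ + k₁ + k₂ + 1 by ring,
    h₄ (y := k₂ + k₁ + k₂) (by positivity), mul_add_one, Real.rpow_add (by norm_num),
    show (2 : ℝ) ^ (-12 : ℝ) = 1 / 4096 by
      rw [show (-12 : ℝ) = ((-12 : ℤ) : ℝ) by norm_num, Real.rpow_intCast]; norm_num]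
  ring

lemma log_realGarvanOpdamF4 {k₁ k₂ : ℝ} (hk₁ : 0 ≤ k₁) (hk₂ : 0 ≤ k₂) :
    Real.log (realGarvanOpdamF4 k₁ k₂) = (-12 * Real.log 2) * k₁ +
      (Real.log (Real.Gamma (2 * k₂ + 1)) + Real.log (Real.Gamma (3 * k₂ + 1)) -
        2 * Real.log (Real.Gamma (k₂ + 1))) +
      Real.log (Real.Gamma (4 * k₁ + (4 * k₂ + 1))) +
      Real.log (Real.Gamma (6 * k₁ + (6 * k₂ + 1))) +
      (-1) * Real.log (Real.Gamma (1 * k₁ + (k₂ + 1))) +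
      (-1) * Real.log (Real.Gamma (3 * k₁ + (3 * k₂ + 1))) +
      Real.log (Real.Gamma (2 * k₁ + 1)) + Real.log (Real.Gamma (3 * k₁ + 1)) +
      Real.log (Real.Gamma (4 * k₁ + (2 * k₂ + 1))) + (-2) * Real.log (Real.Gamma (1 * k₁ + 1)) +
      (-1) * Real.log (Real.Gamma (2 * k₁ + (k₂ + 1))) +
      Real.log (Real.Gamma (2 * k₁ + (4 * k₂ + 1))) +
      (-1) * Real.log (Real.Gamma (1 * k₁ + (2 * k₂ + 1))) := by
  have h {y : ℝ} (hy : 0 < y) : Real.Gamma y ≠ 0 := (Real.Gamma_pos_of_pos hy).ne'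
  have p₁ := h (y := k₁ + k₂ + 1) (by positivity)
  have p₂ := h (y := 3 * (k₁ + k₂) + 1) (by positivity)
  have p₃ := h (y := k₁ + 1) (by positivity)
  have p₄ := h (y := k₁ + k₁ + k₂ + 1) (by positivity)
  have p₅ := h (y := k₂ + 1) (by positivity)
  have p₆ := h (y := k₂ + k₁ + k₂ + 1) (by positivity)
  have n₁ := h (y := 4 * (k₁ + k₂) + 1) (by positivity)
  have n₂ := h (y := 6 * (k₁ + k₂) + 1) (by positivity)
  have n₃ := h (y := 2 * k₁ + 1) (by positivity)
  have n₄ := h (y := 3 * k₁ + 1) (by positivity)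
  have n₅ := h (y := 2 * k₁ + 2 * (k₁ + k₂) + 1) (by positivity)
  have n₆ := h (y := 2 * k₂ + 1) (by positivity)
  have n₇ := h (y := 3 * k₂ + 1) (by positivity)
  have n₈ := h (y := 2 * k₂ + 2 * (k₁ + k₂) + 1) (by positivity)
  have hw : (2 : ℝ) ^ (-12 * k₁) ≠ 0 := by positivity
  rw [realGarvanOpdamF4, Real.log_mul (by positivity) (by positivity),
    Real.log_mul (by positivity) (by positivity), Real.log_mul (by positivity) (by positivity),
    Real.log_div (by positivity) (by positivity), Real.log_div (by positivity) (by positivity),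
    Real.log_div (by positivity) (by positivity), Real.log_mul n₁ n₂, Real.log_mul p₁ p₂,
    Real.log_mul (by positivity) n₅, Real.log_mul n₃ n₄, Real.log_mul (by positivity) p₄,
    Real.log_mul (by positivity) n₈, Real.log_mul n₆ n₇, Real.log_mul (by positivity) p₆,
    Real.log_pow, Real.log_pow, Real.log_rpow (by norm_num)]
  push_cast
  ring_nf

lemma asympAffine_log_realGarvanOpdamF4 {k₂ : ℝ} (hk₂ : 0 ≤ k₂) :
    AsympAffine fun k₁ => Real.log (realGarvanOpdamF4 k₁ k₂) := by
  have h (m : ℕ) (hm : 0 < m) (b : ℝ) (hb : 0 < b) := asympAffine_log_Gamma hm hb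
  have h₁ := h 1 (by norm_num)
  have h₂ := h 2 (by norm_num)
  have h₃ := h 3 (by norm_num)
  have h₄ := h 4 (by norm_num)
  have h₆ := h 6 (by norm_num)
  push_cast at h₁ h₂ h₃ h₄ h₆
  refine AsympAffine.congr ?_ fun k₁ hk₁ => log_realGarvanOpdamF4 (zero_le_one.trans hk₁) hk₂
  exact ((((((((((((AsympAffine.affine _ _).add (h₄ _ (by positivity))).add
    (h₆ _ (by positivity))).add ((h₁ _ (by positivity)).const_mul _)).add
    ((h₃ _ (by positivity)).const_mul _)).add (h₂ _ (by positivity))).add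
    (h₃ _ (by positivity))).add (h₄ _ (by positivity))).add
    ((h₁ _ (by positivity)).const_mul _)).add ((h₂ _ (by positivity)).const_mul _)).add
    (h₂ _ (by positivity))).add ((h₁ _ (by positivity)).const_mul _))

lemma realMehtaF4_div_eq_left {k₁ k₂ : ℝ} (hk₁ : 1 ≤ k₁) (hk₂ : 1 ≤ k₂) :
    realMehtaF4 k₁ k₂ / realGarvanOpdamF4 k₁ k₂ = realMehtaF4 1 k₂ / realGarvanOpdamF4 1 k₂ := by
  have hk₂' := zero_le_one.trans hk₂
  have h := sub_eq_sub_of_convexOn (convexOn_log_realMehtaF4 hk₂')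
    (asympAffine_log_realGarvanOpdamF4 hk₂') (fun x hx => by
      have hx' := zero_le_one.trans hx
      have p := (realMehtaF4_pos hx' hk₂').ne'
      have p' := (realGarvanOpdamF4_pos hx' hk₂').ne'
      rw [F4.realMehtaF4_add_one hx hk₂, realGarvanOpdamF4_add_one hx' hk₂',
        Real.log_mul (by positivity) p, Real.log_mul (by positivity) p', add_sub_cancel_right,
        add_sub_cancel_right]) hk₁
  have hk₁' := zero_le_one.trans hk₁
  rw [← Real.log_div (realMehtaF4_pos hk₁' hk₂').ne' (realGarvanOpdamF4_pos hk₁' hk₂').ne',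
    ← Real.log_div (realMehtaF4_pos zero_le_one hk₂').ne'
      (realGarvanOpdamF4_pos zero_le_one hk₂').ne'] at h
  exact Real.log_injOn_pos
    (div_pos (realMehtaF4_pos hk₁' hk₂') (realGarvanOpdamF4_pos hk₁' hk₂'))
    (div_pos (realMehtaF4_pos zero_le_one hk₂') (realGarvanOpdamF4_pos zero_le_one hk₂')) h

lemma realMehtaF4_div_comm (k₁ k₂ : ℝ) :
    realMehtaF4 k₂ k₁ / realGarvanOpdamF4 k₂ k₁ =
      realMehtaF4 k₁ k₂ / realGarvanOpdamF4 k₁ k₂ := by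
  rw [realMehtaF4_comm, realGarvanOpdamF4_comm, mul_div_mul_left _ _ (by positivity)]

/-- The evaluation for large real parameters, up to a constant. -/
theorem exists_realMehtaF4_eq :
    ∃ c : ℝ, ∀ k₁ k₂ : ℝ, 1 ≤ k₁ → 1 ≤ k₂ → realMehtaF4 k₁ k₂ = c * realGarvanOpdamF4 k₁ k₂ := by
  refine ⟨realMehtaF4 1 1 / realGarvanOpdamF4 1 1, fun k₁ k₂ hk₁ hk₂ => ?_⟩
  rw [← div_eq_iff (realGarvanOpdamF4_pos (zero_le_one.trans hk₁) (zero_le_one.trans hk₂)).ne',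
    realMehtaF4_div_eq_left hk₁ hk₂, realMehtaF4_div_comm, realMehtaF4_div_eq_left hk₂ le_rfl]

/-- The density of the Macdonald-Mehta integral of `F₄` at complex parameters. -/
def weightF4 (k₁ k₂ : ℂ) (x : Fin 4 → ℝ) : ℂ :=
  ((|deltaShortF4 x| : ℝ) : ℂ) ^ (2 * k₁) * ((|deltaLongF4 x| : ℝ) : ℂ) ^ (2 * k₂) *
    Complex.exp (-(∑ i, ((x i : ℂ)) ^ 2) / 2)

/-- The unnormalized Macdonald-Mehta integral of `F₄` at complex parameters. -/
def mehtaF4 (k₁ k₂ : ℂ) : ℂ :=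
  ∫ x, weightF4 k₁ k₂ x

/-- The Garvan-Opdam product for complex parameters. -/
def garvanOpdamF4 (k₁ k₂ : ℂ) : ℂ :=
  (2 : ℂ) ^ (-12 * k₁) *
    (Complex.Gamma (4 * (k₁ + k₂) + 1) * Complex.Gamma (6 * (k₁ + k₂) + 1) /
      (Complex.Gamma (k₁ + k₂ + 1) * Complex.Gamma (3 * (k₁ + k₂) + 1))) *
    ((Complex.Gamma (2 * k₁ + 1) * Complex.Gamma (3 * k₁ + 1) *
        Complex.Gamma (2 * k₁ + 2 * (k₁ + k₂) + 1) /
      (Complex.Gamma (k₁ + 1) ^ 2 * Complex.Gamma (k₁ + k₁ + k₂ + 1))) *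
     (Complex.Gamma (2 * k₂ + 1) * Complex.Gamma (3 * k₂ + 1) *
        Complex.Gamma (2 * k₂ + 2 * (k₁ + k₂) + 1) /
      (Complex.Gamma (k₂ + 1) ^ 2 * Complex.Gamma (k₂ + k₁ + k₂ + 1))))

lemma weightF4_ofReal (k₁ k₂ : ℝ) (x : Fin 4 → ℝ) :
    weightF4 k₁ k₂ x = (realWeightF4 k₁ k₂ x : ℝ) := by
  rw [weightF4, realWeightF4, normSqFour, Complex.ofReal_mul, Complex.ofReal_mul,
    Complex.ofReal_cpow (abs_nonneg _), Complex.ofReal_cpow (abs_nonneg _)]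
  push_cast
  rfl

lemma mehtaF4_ofReal (k₁ k₂ : ℝ) : mehtaF4 k₁ k₂ = (realMehtaF4 k₁ k₂ : ℝ) := by
  simp only [mehtaF4, weightF4_ofReal, realMehtaF4]
  exact integral_ofReal

lemma garvanOpdamF4_ofReal (k₁ k₂ : ℝ) :
    garvanOpdamF4 k₁ k₂ = (realGarvanOpdamF4 k₁ k₂ : ℝ) := by
  rw [garvanOpdamF4, realGarvanOpdamF4]
  push_cast [← Complex.Gamma_ofReal, Complex.ofReal_cpow (zero_le_two (α := ℝ))]
  rfl

lemma realWeightF4_eq_exp {x : Fin 4 → ℝ} (hs : deltaShortF4 x ≠ 0) (hl : deltaLongF4 x ≠ 0)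
    (k₁ k₂ : ℝ) : realWeightF4 k₁ k₂ x = Real.exp (2 * k₁ * Real.log |deltaShortF4 x| +
      2 * k₂ * Real.log |deltaLongF4 x| - normSqFour x / 2) := by
  rw [realWeightF4, Real.rpow_def_of_pos (abs_pos.2 hs), Real.rpow_def_of_pos (abs_pos.2 hl),
    ← Real.exp_add, ← Real.exp_add]
  ring_nf

lemma weightF4_eq_exp {x : Fin 4 → ℝ} (hs : deltaShortF4 x ≠ 0) (hl : deltaLongF4 x ≠ 0)
    (k₁ k₂ : ℂ) : weightF4 k₁ k₂ x = Complex.exp (2 * k₁ * (Real.log |deltaShortF4 x| : ℝ) +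
      2 * k₂ * (Real.log |deltaLongF4 x| : ℝ) - (normSqFour x : ℝ) / 2) := by
  rw [weightF4, Complex.cpow_def_of_ne_zero (by simpa using hs),
    Complex.cpow_def_of_ne_zero (by simpa using hl), ← Complex.exp_add, ← Complex.exp_add,
    Complex.ofReal_log (abs_nonneg _), Complex.ofReal_log (abs_nonneg _), normSqFour]
  push_cast
  ring_nf

lemma norm_weightF4 {x : Fin 4 → ℝ} (hs : deltaShortF4 x ≠ 0) (hl : deltaLongF4 x ≠ 0)
    (k₁ k₂ : ℂ) : ‖weightF4 k₁ k₂ x‖ = realWeightF4 k₁.re k₂.re x := by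
  rw [weightF4_eq_exp hs hl, realWeightF4_eq_exp hs hl, Complex.norm_exp]
  congr 1
  simp

lemma measurable_weightF4 (k₁ k₂ : ℂ) : Measurable (weightF4 k₁ k₂) := by
  unfold weightF4
  have := measurable_deltaShortF4
  have := measurable_deltaLongF4
  fun_prop

/-- The exponent by which the density of `F₄` changes in the direction `(a₁, a₂)` of parameters. -/
def slopeF4 (a₁ a₂ : ℝ) (x : Fin 4 → ℝ) : ℝ :=
  2 * a₁ * Real.log |deltaShortF4 x| + 2 * a₂ * Real.log |deltaLongF4 x|

/-- The measure with density `realWeightF4 b₁ b₂`. -/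
def measureF4 (b₁ b₂ : ℝ) : Measure (Fin 4 → ℝ) :=
  volume.withDensity fun x => ENNReal.ofReal (realWeightF4 b₁ b₂ x)

lemma integrable_exp_slopeF4 {a₁ a₂ b₁ b₂ t : ℝ} (h₁ : 0 ≤ b₁ + t * a₁) (h₂ : 0 ≤ b₂ + t * a₂) :
    Integrable (fun x => Real.exp (t * slopeF4 a₁ a₂ x)) (measureF4 b₁ b₂) := by
  rw [measureF4, integrable_withDensity_iff (measurable_realWeightF4 b₁ b₂).ennreal_ofReal
    (.of_forall fun _ => ENNReal.ofReal_lt_top)]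
  refine (integrable_realWeightF4 h₁ h₂).congr ?_
  filter_upwards [ae_deltaShortF4_ne_zero, ae_deltaLongF4_ne_zero] with x hs hl
  rw [ENNReal.toReal_ofReal (realWeightF4_nonneg _ _ _), realWeightF4_eq_exp hs hl,
    realWeightF4_eq_exp hs hl, ← Real.exp_add, slopeF4]
  ring_nf

open ProbabilityTheory in
lemma complexMGF_slopeF4 (a₁ a₂ b₁ b₂ : ℝ) (z : ℂ) :
    complexMGF (slopeF4 a₁ a₂) (measureF4 b₁ b₂) z = mehtaF4 (b₁ + z * a₁) (b₂ + z * a₂) := by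
  rw [complexMGF, measureF4, integral_withDensity_eq_integral_toReal_smul
    (measurable_realWeightF4 b₁ b₂).ennreal_ofReal (.of_forall fun _ => ENNReal.ofReal_lt_top)]
  refine integral_congr_ae ?_
  filter_upwards [ae_deltaShortF4_ne_zero, ae_deltaLongF4_ne_zero] with x hs hl
  rw [ENNReal.toReal_ofReal (realWeightF4_nonneg _ _ _), realWeightF4_eq_exp hs hl,
    weightF4_eq_exp hs hl, Complex.real_smul, slopeF4, Complex.ofReal_exp, ← Complex.exp_add]
  push_cast
  ring_nf

lemma differentiableAt_mehtaF4 {a₁ a₂ b₁ b₂ : ℝ} {z : ℂ} (h₁ : 0 < b₁ + z.re * a₁)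
    (h₂ : 0 < b₂ + z.re * a₂) :
    DifferentiableAt ℂ (fun z => mehtaF4 (b₁ + z * a₁) (b₂ + z * a₂)) z := by
  simp only [← complexMGF_slopeF4]
  refine (ProbabilityTheory.hasDerivAt_complexMGF ?_).differentiableAt
  have ho : IsOpen {t : ℝ | 0 < b₁ + t * a₁ ∧ 0 < b₂ + t * a₂} :=
    (isOpen_lt (by fun_prop) (by fun_prop)).and (isOpen_lt (by fun_prop) (by fun_prop))
  exact interior_maximal (fun t ht => integrable_exp_slopeF4 ht.1.le ht.2.le) ho ⟨h₁, h₂⟩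

lemma Complex.differentiableAt_Gamma_of_re_pos {s : ℂ} (hs : 0 < s.re) :
    DifferentiableAt ℂ Complex.Gamma s := by
  refine Complex.differentiableAt_Gamma s fun m hm => ?_
  rw [hm] at hs
  simp only [neg_re, natCast_re, Left.neg_pos_iff] at hs
  exact hs.not_ge m.cast_nonneg

lemma differentiableAt_garvanOpdamF4 {f g : ℂ → ℂ} {z : ℂ} (hf : DifferentiableAt ℂ f z)
    (hg : DifferentiableAt ℂ g z) (hf₀ : 0 ≤ (f z).re) (hg₀ : 0 ≤ (g z).re) :
    DifferentiableAt ℂ (fun z => garvanOpdamF4 (f z) (g z)) z := by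
  have hd {h : ℂ → ℂ} (hh : DifferentiableAt ℂ h z) (hp : 0 < (h z).re) :
      DifferentiableAt ℂ (fun z => Complex.Gamma (h z)) z :=
    (Complex.differentiableAt_Gamma_of_re_pos hp).comp z hh
  have hn {s : ℂ} (hs : 0 < s.re) := Complex.Gamma_ne_zero_of_re_pos hs
  unfold garvanOpdamF4
  have hpow : DifferentiableAt ℂ (fun z => (2 : ℂ) ^ (-12 * f z)) z :=
    (hf.const_mul _).const_cpow (.inl two_ne_zero)
  refine (hpow.mul (((hd ?_ ?_).mul (hd ?_ ?_)).div ((hd ?_ ?_).mul (hd ?_ ?_))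
    (mul_ne_zero (hn ?_) (hn ?_)))).mul
    (((((hd ?_ ?_).mul (hd ?_ ?_)).mul (hd ?_ ?_)).div (((hd ?_ ?_).pow 2).mul (hd ?_ ?_))
    (mul_ne_zero (pow_ne_zero 2 (hn ?_)) (hn ?_))).mul
    ((((hd ?_ ?_).mul (hd ?_ ?_)).mul (hd ?_ ?_)).div (((hd ?_ ?_).pow 2).mul (hd ?_ ?_))
    (mul_ne_zero (pow_ne_zero 2 (hn ?_)) (hn ?_)))) <;>
  first
  | fun_prop
  | simp only [add_re, mul_re, re_ofNat, im_ofNat, zero_mul, sub_zero, one_re]; positivity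

open Filter Topology in
/-- The identity theorem for holomorphic functions that agree on a real interval. -/
lemma eqOn_of_eq_ofReal {f g : ℂ → ℂ} {U : Set ℂ} (hU : IsOpen U) (hU' : IsPreconnected U)
    (hf : DifferentiableOn ℂ f U) (hg : DifferentiableOn ℂ g U) {t₀ : ℝ} (ht₀ : (t₀ : ℂ) ∈ U)
    (h : ∀ t : ℝ, t₀ ≤ t → (t : ℂ) ∈ U → f t = g t) : Set.EqOn f g U := by
  refine (hf.analyticOnNhd hU).eqOn_of_preconnected_of_frequently_eq (hg.analyticOnNhd hU) hU'
    ht₀ ?_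
  have hc : Tendsto (fun t : ℝ => (t : ℂ)) (𝓝[>] t₀) (𝓝[≠] (t₀ : ℂ)) :=
    tendsto_nhdsWithin_iff.2 ⟨(Complex.continuous_ofReal.tendsto t₀).mono_left nhdsWithin_le_nhds,
      eventually_nhdsWithin_of_forall fun t (ht : t₀ < t) => by simpa using ht.ne'⟩
  refine hc.frequently (Eventually.frequently ?_)
  have hU₀ : ∀ᶠ t : ℝ in 𝓝[>] t₀, (t : ℂ) ∈ U :=
    (hc.mono_right nhdsWithin_le_nhds).eventually (hU.mem_nhds ht₀)
  filter_upwards [hU₀, self_mem_nhdsWithin] with t ht ht'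
  exact h t (le_of_lt ht') ht

/-- The Garvan-Opdam evaluation propagates along a complexified line of parameters. -/
lemma mehtaF4_eq_of_line {c : ℂ} {a₁ a₂ b₁ b₂ t₀ : ℝ} (h₁ : 0 < b₁ + t₀ * a₁)
    (h₂ : 0 < b₂ + t₀ * a₂)
    (h : ∀ t : ℝ, t₀ ≤ t → 0 < b₁ + t * a₁ → 0 < b₂ + t * a₂ →
      mehtaF4 (b₁ + t * a₁) (b₂ + t * a₂) = c * garvanOpdamF4 (b₁ + t * a₁) (b₂ + t * a₂))
    {z : ℂ} (hz₁ : 0 < b₁ + z.re * a₁) (hz₂ : 0 < b₂ + z.re * a₂) :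
    mehtaF4 (b₁ + z * a₁) (b₂ + z * a₂) = c * garvanOpdamF4 (b₁ + z * a₁) (b₂ + z * a₂) := by
  have ho : IsOpen {z : ℂ | 0 < b₁ + z.re * a₁ ∧ 0 < b₂ + z.re * a₂} :=
    (isOpen_lt (by fun_prop) (by fun_prop)).and (isOpen_lt (by fun_prop) (by fun_prop))
  have hc : Convex ℝ {z : ℂ | 0 < b₁ + z.re * a₁ ∧ 0 < b₂ + z.re * a₂} := by
    intro x hx y hy s t hs ht hst
    have e (b a : ℝ) : b + (s • x + t • y).re * a = s * (b + x.re * a) + t * (b + y.re * a) := by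
      simp only [add_re, real_smul, re_ofReal_mul]
      linear_combination (-b) * hst
    have pos {u v : ℝ} (hu : 0 < u) (hv : 0 < v) : 0 < s * u + t * v := by
      rcases hs.eq_or_lt with rfl | hs
      · rw [zero_add] at hst; subst hst; simpa using hv
      · positivity
    simp only [Set.mem_ofPred_eq, e]
    exact ⟨pos hx.1 hy.1, pos hx.2 hy.2⟩
  refine eqOn_of_eq_ofReal (f := fun z => mehtaF4 (b₁ + z * a₁) (b₂ + z * a₂))
    (g := fun z => c * garvanOpdamF4 (b₁ + z * a₁) (b₂ + z * a₂)) (t₀ := t₀) ho hc.isPreconnected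
    (fun z hz => (differentiableAt_mehtaF4 hz.1 hz.2).differentiableWithinAt) (fun z hz => ?_)
    ⟨by simpa using h₁, by simpa using h₂⟩ (fun t ht ht' => h t ht ?_ ?_) ⟨hz₁, hz₂⟩
  · refine (DifferentiableAt.const_mul (differentiableAt_garvanOpdamF4 (by fun_prop) (by fun_prop)
      ?_ ?_) c).differentiableWithinAt
    · simpa using hz.1.le
    · simpa using hz.2.le
  · simpa using ht'.1
  · simpa using ht'.2

open Filter Topology in
lemma tendsto_mehtaF4 {k₁ k₂ : ℂ} (hk₁ : 0 ≤ k₁.re) (hk₂ : 0 ≤ k₂.re) :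
    Tendsto (fun t : ℝ => mehtaF4 (k₁ + t) (k₂ + t)) (𝓝[>] 0) (𝓝 (mehtaF4 k₁ k₂)) := by
  refine tendsto_integral_filter_of_dominated_convergence
    (fun x => realWeightF4 k₁.re k₂.re x + realWeightF4 (k₁.re + 1) (k₂.re + 1) x)
    (.of_forall fun t => (measurable_weightF4 _ _).aestronglyMeasurable) ?_
    ((integrable_realWeightF4 hk₁ hk₂).add (integrable_realWeightF4 (by positivity)
      (by positivity))) ?_
  · filter_upwards [Ioo_mem_nhdsGT (zero_lt_one (α := ℝ))] with t ht
    filter_upwards [ae_deltaShortF4_ne_zero, ae_deltaLongF4_ne_zero] with x hs hl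
    rw [norm_weightF4 hs hl]
    simp only [add_re, ofReal_re, realWeightF4_eq_exp hs hl]
    set A := 2 * k₁.re * Real.log |deltaShortF4 x| + 2 * k₂.re * Real.log |deltaLongF4 x| -
      normSqFour x / 2 with hA
    set B := 2 * Real.log |deltaShortF4 x| + 2 * Real.log |deltaLongF4 x| with hB
    rw [show 2 * (k₁.re + t) * Real.log |deltaShortF4 x| +
      2 * (k₂.re + t) * Real.log |deltaLongF4 x| - normSqFour x / 2 = A + t * B by
        rw [hA, hB]; ring, show 2 * (k₁.re + 1) * Real.log |deltaShortF4 x| +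
      2 * (k₂.re + 1) * Real.log |deltaLongF4 x| - normSqFour x / 2 = A + B by rw [hA, hB]; ring]
    rcases le_total 0 B with hB₀ | hB₀
    · refine (Real.exp_le_exp.2 ?_).trans (le_add_of_nonneg_left (Real.exp_pos A).le)
      nlinarith [ht.2]
    · refine (Real.exp_le_exp.2 ?_).trans (le_add_of_nonneg_right (Real.exp_pos _).le)
      nlinarith [ht.1]
  · filter_upwards [ae_deltaShortF4_ne_zero, ae_deltaLongF4_ne_zero] with x hs hl
    simp only [weightF4_eq_exp hs hl]
    refine (Continuous.tendsto' ?_ 0 _ ?_).mono_left nhdsWithin_le_nhds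
    · fun_prop
    · simp

lemma mehtaF4_zero : mehtaF4 0 0 = ((2 * Real.pi : ℝ) : ℂ) ^ 2 := by
  have h : realMehtaF4 0 0 = (2 * Real.pi) ^ 2 := by
    have h := integral_fintype_prod_volume_eq_pow (ι := Fin 4) fun y : ℝ =>
      Real.exp (-(1 / 2) * y ^ 2)
    rw [integral_gaussian, Fintype.card_fin, show √(Real.pi / (1 / 2)) ^ 4 =
      (√(Real.pi / (1 / 2)) ^ 2) ^ 2 by ring, Real.sq_sqrt (by positivity)] at h
    rw [show 2 * Real.pi = Real.pi / (1 / 2) by ring, ← h, realMehtaF4]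
    congr 1 with x
    rw [realWeightF4, normSqFour, ← Real.exp_sum, ← mul_sum]
    simp only [mul_zero, Real.rpow_zero, one_mul]
    ring_nf
  simpa [h] using mehtaF4_ofReal 0 0

lemma garvanOpdamF4_zero : garvanOpdamF4 0 0 = 1 := by
  simp [garvanOpdamF4]

open Filter Topology in
/-- The Macdonald-Mehta integral of `F₄`, without its normalization. -/
theorem mehtaF4_eq {k₁ k₂ : ℂ} (hk₁ : 0 ≤ k₁.re) (hk₂ : 0 ≤ k₂.re) :
    mehtaF4 k₁ k₂ = ((2 * Real.pi : ℝ) : ℂ) ^ 2 * garvanOpdamF4 k₁ k₂ := by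
  obtain ⟨c, hc⟩ := exists_realMehtaF4_eq
  have hreal (k₁ k₂ : ℝ) (h₁ : 0 < k₁) (h₂ : 0 < k₂) :
      mehtaF4 k₁ k₂ = c * garvanOpdamF4 k₁ k₂ := by
    have := mehtaF4_eq_of_line (c := c) (a₁ := 1) (a₂ := 1) (b₁ := k₁) (b₂ := k₂) (t₀ := 1)
      (by positivity) (by positivity) (fun t ht _ _ => by
        have := hc (k₁ + t * 1) (k₂ + t * 1) (by linarith) (by linarith)
        rw [← Complex.ofReal_mul, ← Complex.ofReal_add, ← Complex.ofReal_add, mehtaF4_ofReal,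
          garvanOpdamF4_ofReal, this, Complex.ofReal_mul]) (z := 0) (by simpa) (by simpa)
    simpa using this
  have hpos (k₁ k₂ : ℂ) (h₁ : 0 < k₁.re) (h₂ : 0 < k₂.re) :
      mehtaF4 k₁ k₂ = c * garvanOpdamF4 k₁ k₂ := by
    have := mehtaF4_eq_of_line (c := c) (a₁ := k₁.im) (a₂ := k₂.im) (b₁ := k₁.re) (b₂ := k₂.re)
      (t₀ := 0) (by simpa) (by simpa) (fun t _ h₁ h₂ => by
        simpa using hreal _ _ h₁ h₂) (z := I) (by simpa) (by simpa)
    simpa [mul_comm I, re_add_im] using this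
  have hnonneg (k₁ k₂ : ℂ) (h₁ : 0 ≤ k₁.re) (h₂ : 0 ≤ k₂.re) :
      mehtaF4 k₁ k₂ = c * garvanOpdamF4 k₁ k₂ := by
    refine tendsto_nhds_unique (tendsto_mehtaF4 h₁ h₂) ?_
    have hg : ContinuousAt (fun z : ℂ => garvanOpdamF4 (k₁ + z) (k₂ + z)) 0 :=
      (differentiableAt_garvanOpdamF4 (by fun_prop) (by fun_prop) (by simpa)
        (by simpa)).continuousAt
    have hg' : Tendsto (fun t : ℝ => garvanOpdamF4 (k₁ + t) (k₂ + t)) (𝓝[>] 0)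
        (𝓝 (garvanOpdamF4 k₁ k₂)) := by
      have := hg.tendsto.comp (Complex.continuous_ofReal.tendsto' 0 0 Complex.ofReal_zero)
      simp only [add_zero] at this
      exact this.mono_left nhdsWithin_le_nhds
    refine (hg'.const_mul (c : ℂ)).congr' ?_
    filter_upwards [self_mem_nhdsWithin] with t (ht : 0 < t)
    exact (hpos _ _ (by simpa using by positivity) (by simpa using by positivity)).symm
  have h₀ := hnonneg 0 0 le_rfl le_rfl
  rw [mehtaF4_zero, garvanOpdamF4_zero, mul_one] at h₀
  rw [h₀, hnonneg k₁ k₂ hk₁ hk₂]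

/-- The two-parameter Macdonald-Mehta integral for `F₄` (Garvan–Opdam):
for `Re k₁, Re k₂ ≥ 0`,
`∫_{ℝ⁴}|Δ_s|^{2k₁}|Δ_l|^{2k₂} dγ = 2^{-12k₁}
  · Γ(4(k₁+k₂)+1)Γ(6(k₁+k₂)+1)/(Γ(k₁+k₂+1)Γ(3(k₁+k₂)+1))
  · ∏_{j=1,2} Γ(2k_j+1)Γ(3k_j+1)Γ(2k_j+2(k₁+k₂)+1)/(Γ(k_j+1)²Γ(k_j+k₁+k₂+1))`. -/
theorem macdonald_mehta_F4 (k₁ k₂ : ℂ) (hk₁ : 0 ≤ k₁.re) (hk₂ : 0 ≤ k₂.re) :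
    ((2 * Real.pi : ℝ) : ℂ) ^ (-(4 : ℂ) / 2) *
      ∫ x : Fin 4 → ℝ,
        ((|deltaShortF4 x| : ℝ) : ℂ) ^ (2 * k₁) *
        ((|deltaLongF4 x| : ℝ) : ℂ) ^ (2 * k₂) *
        Complex.exp (-(∑ i, ((x i : ℂ)) ^ 2) / 2)
      = (2 : ℂ) ^ (-12 * k₁) *
        (Complex.Gamma (4 * (k₁ + k₂) + 1) * Complex.Gamma (6 * (k₁ + k₂) + 1) /
          (Complex.Gamma (k₁ + k₂ + 1) * Complex.Gamma (3 * (k₁ + k₂) + 1))) *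
        ((Complex.Gamma (2 * k₁ + 1) * Complex.Gamma (3 * k₁ + 1) *
            Complex.Gamma (2 * k₁ + 2 * (k₁ + k₂) + 1) /
          (Complex.Gamma (k₁ + 1) ^ 2 * Complex.Gamma (k₁ + k₁ + k₂ + 1))) *
         (Complex.Gamma (2 * k₂ + 1) * Complex.Gamma (3 * k₂ + 1) *
            Complex.Gamma (2 * k₂ + 2 * (k₁ + k₂) + 1) /
          (Complex.Gamma (k₂ + 1) ^ 2 * Complex.Gamma (k₂ + k₁ + k₂ + 1)))) := by
  have hπ : ((2 * Real.pi : ℝ) : ℂ) ^ 2 ≠ 0 :=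
    pow_ne_zero 2 (Complex.ofReal_ne_zero.2 Real.two_pi_pos.ne')
  rw [show -(4 : ℂ) / 2 = -(2 : ℕ) by norm_num, Complex.cpow_neg, Complex.cpow_natCast]
  change _ * mehtaF4 k₁ k₂ = garvanOpdamF4 k₁ k₂
  rw [mehtaF4_eq hk₁ hk₂, inv_mul_cancel_left₀ hπ]

end
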